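/- arXiv:1104.5472 — 2 statements merged into one kernel-verified Lean document; each statement's English description precedes it below -/
import Mathlib

section
/- Let σ₁, σ₂ be commuting involutions of g with quaternionic decomposition g = g₀₀ ⊕ g₀₁ ⊕ g₁₀ ⊕ g₁₁, and suppose both σ₁ and σ₂ are of maximal rank. Then: (i) any Cartan subspace of g₁₁ is also a Cartan subspace of g₁₀ ⊕ g₁₁ and of g₀₁ ⊕ g₁₁; (ii) any Cartan subspace of g₀₁ is also a Cartan subspace of g₁₀ ⊕ g₀₁; (iii) any Cartan subspace of g₁₀ is also a Cartan subspace of g₁₀ ⊕ g₀₁. -/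
open LieAlgebra Module

variable (k : Type*) [Field k] [IsAlgClosed k] [CharZero k]
variable (g : Type*) [LieRing g] [LieAlgebra k g] [FiniteDimensional k g]
  [LieAlgebra.IsSemisimple k g]

/-- The eigenspace of a Lie algebra automorphism `σ` for the eigenvalue `c`. -/
noncomputable def eigSub (σ : g ≃ₗ⁅k⁆ g) (c : k) : Submodule k g :=
  Module.End.eigenspace (σ.toLinearEquiv : g →ₗ[k] g) c

/-- A Lie algebra involution: an automorphism `σ` with `σ ∘ σ = id`. -/
def IsInvolution (σ : g ≃ₗ⁅k⁆ g) : Prop := ∀ x, σ (σ x) = x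

/-- Two commuting involutions. -/
def CommutingInvolutions (σ₁ σ₂ : g ≃ₗ⁅k⁆ g) : Prop :=
  IsInvolution k g σ₁ ∧ IsInvolution k g σ₂ ∧ ∀ x, σ₁ (σ₂ x) = σ₂ (σ₁ x)

/-- The subspace `g_{ij}` of the quaternionic decomposition determined by commuting
involutions `σ₁, σ₂`: here `i, j : Bool` and `false, true` encode the exponents `0, 1`
of the eigenvalues `(-1)^i`, `(-1)^j`. -/
noncomputable def qSpace (σ₁ σ₂ : g ≃ₗ⁅k⁆ g) (i j : Bool) : Submodule k g :=
  eigSub k g σ₁ (if i then -1 else 1) ⊓ eigSub k g σ₂ (if j then -1 else 1)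

/-- `x` is a semisimple element of `g`: `ad x` is a semisimple endomorphism. -/
def IsSSElt (x : g) : Prop := Module.End.IsSemisimple (ad k g x)

/-- `x` is a nilpotent element of `g`: `ad x` is a nilpotent endomorphism. -/
def IsNilpElt (x : g) : Prop := IsNilpotent (ad k g x)

/-- `x` is a regular element of `g`: the dimension of its centralizer equals the rank of `g`,
i.e. the dimension of a Cartan subalgebra of `g`. -/
def IsRegElt (x : g) : Prop :=
  ∃ H : LieSubalgebra k g, H.IsCartanSubalgebra ∧
    Module.finrank k (LinearMap.ker (ad k g x)) = Module.finrank k H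

/-- An involution is of maximal rank if its `(-1)`-eigenspace contains a Cartan
subalgebra of `g`. -/
def IsMaxRank (σ : g ≃ₗ⁅k⁆ g) : Prop :=
  ∃ H : LieSubalgebra k g, H.IsCartanSubalgebra ∧ H.toSubmodule ≤ eigSub k g σ (-1)

/-- The centralizer of an element `x`, as a Lie subalgebra of `g`. -/
def zg (x : g) : LieSubalgebra k g where
  carrier := {y | ⁅x, y⁆ = 0}
  add_mem' := by
    intro a b ha hb
    simp only [Set.mem_setOf_eq] at *
    rw [lie_add, ha, hb, add_zero]
  zero_mem' := by simp
  smul_mem' := by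
    intro t a ha
    simp only [Set.mem_setOf_eq] at *
    rw [lie_smul, ha, smul_zero]
  lie_mem' := by
    intro a b ha hb
    simp only [Set.mem_setOf_eq] at *
    rw [leibniz_lie, ha, hb, lie_zero, zero_lie, add_zero]

/-- The fixed-point subalgebra of a Lie algebra automorphism. -/
def fixSubalgebra (σ : g ≃ₗ⁅k⁆ g) : LieSubalgebra k g where
  carrier := {x | σ x = x}
  add_mem' := by
    intro a b ha hb
    simp only [Set.mem_setOf_eq] at *
    rw [show σ (a + b) = σ a + σ b from σ.toLieHom.map_add a b, ha, hb]
  zero_mem' := by simp only [Set.mem_setOf_eq]; exact σ.toLieHom.map_zero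
  smul_mem' := by
    intro t a ha
    simp only [Set.mem_setOf_eq] at *
    rw [show σ (t • a) = t • σ a from σ.toLieHom.map_smul t a, ha]
  lie_mem' := by
    intro a b ha hb
    simp only [Set.mem_setOf_eq] at *
    rw [LieEquiv.map_lie σ a b, ha, hb]

/-- The exponential of an endomorphism, as a finite sum (which is the genuine exponential
when the endomorphism is nilpotent). -/
noncomputable def expEnd (f : Module.End k g) : Module.End k g :=
  ∑ i ∈ Finset.range (Module.finrank k g + 1), (i.factorial : k)⁻¹ • f ^ i

/-- An automorphism of `g` is inner if it lies in the subgroup of automorphisms generated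
by the exponentials `exp (ad x)` with `ad x` nilpotent. -/
noncomputable def IsInnerAut (μ : g ≃ₗ⁅k⁆ g) : Prop :=
  μ.toLinearEquiv ∈ Subgroup.closure
    {e : g ≃ₗ[k] g | ∃ x : g, IsNilpotent (ad k g x) ∧
      (e : g →ₗ[k] g) = expEnd k g (ad k g x)}

/-- `σ` and `τ` are conjugate by an inner automorphism of `g`. -/
noncomputable def InnerConj (σ τ : g ≃ₗ⁅k⁆ g) : Prop :=
  ∃ φ : g ≃ₗ⁅k⁆ g, IsInnerAut k g φ ∧ ∀ x, τ x = φ (σ (φ.symm x))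

/-- A dyad: a pair of distinct commuting involutions that are conjugate by an inner
automorphism of `g`. -/
noncomputable def IsDyad (σ₁ σ₂ : g ≃ₗ⁅k⁆ g) : Prop :=
  IsInvolution k g σ₁ ∧ IsInvolution k g σ₂ ∧ σ₁ ≠ σ₂ ∧
    (∀ x, σ₁ (σ₂ x) = σ₂ (σ₁ x)) ∧ InnerConj k g σ₁ σ₂

/-- The span of all brackets `⁅x, y⁆` with `x, y` in a subspace `m`. -/
noncomputable def bracketSpan (m : Submodule k g) : Submodule k g :=
  Submodule.span k {z | ∃ x ∈ m, ∃ y ∈ m, z = ⁅x, y⁆}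

/-- `c` is a Cartan subspace of a subspace `m ⊆ g`: it consists of pairwise commuting
semisimple elements of `g` and is maximal among such subspaces of `m`. -/
def IsCartanSubspace (m c : Submodule k g) : Prop :=
  c ≤ m ∧ (∀ x ∈ c, IsSSElt k g x) ∧ (∀ x ∈ c, ∀ y ∈ c, ⁅x, y⁆ = 0) ∧
    ∀ c' : Submodule k g, c' ≤ m → (∀ x ∈ c', IsSSElt k g x) →
      (∀ x ∈ c', ∀ y ∈ c', ⁅x, y⁆ = 0) → c ≤ c' → c' = c


set_option linter.unusedSectionVars false

lemma aux_charpoly {A M ι : Type*} [CommRing A] [Nontrivial A] [AddCommGroup M] [Module A M] [Fintype ι] [DecidableEq ι]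
    (b : Basis ι A M) (f : M →ₗ[A] M) (s : Finset ι) (hs : ∀ i ∈ s, f (b i) = 0) :
    haveI := Module.Free.of_basis b; haveI := Module.Finite.of_basis b
    (Polynomial.X : Polynomial A) ^ s.card ∣ f.charpoly := by
  have := Module.Free.of_basis b; have := Module.Finite.of_basis b
  rw [← LinearMap.charpoly_toMatrix f b, Matrix.charpoly]
  set M0 := LinearMap.toMatrix b b f
  have h : M0.charmatrix = Matrix.of (fun i j => (if j ∈ s then (Polynomial.X : Polynomial A) else 1) *
      (Matrix.of (fun i j => if j ∈ s then (if i = j then (1 : Polynomial A) else 0) else M0.charmatrix i j)) i j) := by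
    ext1 i j
    by_cases hj : j ∈ s
    · have : M0 i j = 0 := by simp [M0, LinearMap.toMatrix_apply, hs j hj]
      by_cases hij : i = j
      · subst hij
        simp [hj, Matrix.charmatrix_apply, this]
      · simp [hj, Matrix.charmatrix_apply, this, hij]
    · simp [hj]
  rw [h, Matrix.det_mul_row]
  apply Dvd.dvd.mul_right
  rw [Finset.prod_ite]
  simp

lemma aux_exp {A L : Type*} [CommRing A] [Algebra ℚ A] [LieRing L] [LieAlgebra A L]
    (t : A) (N : ℕ) (ht : t ^ N = 0) (u : L) :
    ∃ φ : L ≃ₗ⁅A⁆ L, ∀ a, ∃ r, φ a = a + t • ⁅u, a⁆ + t ^ 2 • r := by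
  let _ : Module ℚ L := Module.compHom L (algebraMap ℚ A)
  have : IsScalarTower ℚ A L := IsScalarTower.of_algebraMap_smul (fun r x => rfl)
  let _ : LieAlgebra ℚ L := ⟨fun q x y => by
    rw [← algebraMap_smul A q y, lie_smul, algebraMap_smul]⟩
  let D : LieDerivation A L L := LieDerivation.ad A L (t • u)
  have hD : D.toLinearMap = t • ad A L u := by
    ext y; simp [D]
  have hp : D.toLinearMap ^ (N + 2) = 0 := by
    rw [hD, smul_pow, pow_add, ht]; simp
  have hnil : IsNilpotent D.toLinearMap := ⟨N + 2, hp⟩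
  refine ⟨LieDerivation.exp D hnil, fun a => ⟨∑ i ∈ Finset.range N, ((i + 1 + 1).factorial : ℚ)⁻¹ • (t ^ i • ((ad A L u) ^ (i + 1 + 1)) a), ?_⟩⟩
  rw [LieDerivation.exp_map_apply, IsNilpotent.exp_eq_sum hp, Finset.sum_range_succ', Finset.sum_range_succ']
  rw [hD]
  simp only [smul_pow, LinearMap.add_apply, LinearMap.sum_apply, LinearMap.smul_apply, Finset.smul_sum]
  simp only [zero_add, Nat.factorial, Nat.cast_one, inv_one, pow_one, pow_zero, one_smul, Module.End.one_apply, ad_apply, mul_one]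
  rw [add_assoc, add_comm, add_comm a]
  congr 1
  refine Finset.sum_congr rfl fun i _ => ?_
  rw [smul_comm (t^2) _ _, smul_smul (t ^ 2)]
  congr 2
  ring

section
open TensorProduct
variable {k : Type*} [Field k] {g : Type*} [LieRing g] [LieAlgebra k g] [FiniteDimensional k g]
lemma aux_iter {A : Type*} [CommRing A] [Algebra ℚ A] [Algebra k A] (x v : g)
    (hx : ∀ w : g, ∃ z u : g, ⁅x, z⁆ = 0 ∧ w = z + ⁅u, x⁆) (t : A) (N : ℕ) (ht : t ^ N = 0) (m : ℕ) :
    ∃ φ : (A ⊗[k] g) ≃ₗ⁅A⁆ (A ⊗[k] g), ∃ y ∈ (LinearMap.ker (ad k g x)).baseChange A, ∃ w,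
      φ (1 ⊗ₜ x + t • 1 ⊗ₜ v) = 1 ⊗ₜ x + t • y + t ^ (m + 1) • w := by
  have hdec : ∀ w : A ⊗[k] g, ∃ z ∈ (LinearMap.ker (ad k g x)).baseChange A, ∃ u : A ⊗[k] g, w = z + ⁅u, (1 : A) ⊗ₜ[k] x⁆ := by
    intro w
    induction w with
    | zero => exact ⟨0, zero_mem _, 0, by simp⟩
    | tmul a w =>
      obtain ⟨z, u, hz, rfl⟩ := hx w
      exact ⟨a ⊗ₜ z, Submodule.tmul_mem_baseChange_of_mem a (by simpa using hz), a ⊗ₜ u, by simp [tmul_add]⟩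
    | add w w' h h' =>
      obtain ⟨z, hz, u, rfl⟩ := h
      obtain ⟨z', hz', u', rfl⟩ := h'
      exact ⟨z + z', add_mem hz hz', u + u', by simp; abel⟩
  induction m with
  | zero => exact ⟨LieEquiv.refl, 0, zero_mem _, 1 ⊗ₜ v, by simp⟩
  | succ m ih =>
    obtain ⟨φ, y, hy, w, hw⟩ := ih
    obtain ⟨z, hz, u, rfl⟩ := hdec w
    obtain ⟨ψ, hψ⟩ := aux_exp (L := A ⊗[k] g) (t ^ (m + 1)) N (by rw [← pow_mul, mul_comm, pow_mul, ht, zero_pow (by simp)]) (-u)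
    obtain ⟨r, hr⟩ := hψ (1 ⊗ₜ x + t • y + t ^ (m + 1) • (z + ⁅u, (1 : A) ⊗ₜ[k] x⁆))
    refine ⟨φ.trans ψ, y + t ^ m • z, add_mem hy (Submodule.smul_mem _ _ hz), t ^ m • r - ⁅u, y⁆ - t ^ m • ⁅u, z + ⁅u, (1 : A) ⊗ₜ[k] x⁆⁆, ?_⟩
    rw [LieEquiv.trans_apply, hw, hr]
    simp only [neg_lie, lie_add, lie_smul, smul_add, smul_sub, smul_neg, smul_smul]
    match_scalars <;> ring

open Polynomial in
lemma aux_matrix {A ι : Type*} [CommRing A] [Algebra k A] [Fintype ι] [DecidableEq ι]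
    (b : Basis ι k g) (x v : g) (t : A) :
    (ad A (A ⊗[k] g) (1 ⊗ₜ x + t • 1 ⊗ₜ v)).charpoly =
      (((LinearMap.toMatrix b b (ad k g x)).map (C : k →+* k[X]) +
        (X : k[X]) • (LinearMap.toMatrix b b (ad k g v)).map (C : k →+* k[X])).charpoly).map
          (aeval (R := k) t : k[X] →ₐ[k] A).toRingHom := by
  have h : ad A (A ⊗[k] g) (1 ⊗ₜ x + t • 1 ⊗ₜ v) = (ad k g x).baseChange A + t • (ad k g v).baseChange A := by
    ext y; simp [add_lie, smul_lie]
  rw [h, ← LinearMap.charpoly_toMatrix _ (Algebra.TensorProduct.basis A b), ← Matrix.charpoly_map]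
  congr 1
  rw [map_add, map_smul]
  rw [LinearMap.toMatrix_baseChange, LinearMap.toMatrix_baseChange]
  ext i j
  simp [Matrix.map_apply]
  ring

open Polynomial in
lemma aux_gen {A ι : Type*} [CommRing A] [Nontrivial A] [Algebra ℚ A] [Algebra k A] [Fintype ι] [DecidableEq ι]
    (b : Basis ι k g) (x v : g) (s : Finset ι)
    (hx : ∀ w : g, ∃ z u : g, ⁅x, z⁆ = 0 ∧ w = z + ⁅u, x⁆)
    (hc : ∀ w : g, ⁅x, w⁆ = 0 → ∀ j ∈ s, ⁅w, b j⁆ = 0) (t : A) (N : ℕ) (htN : t ^ N = 0) :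
    (X : A[X]) ^ s.card ∣ (((LinearMap.toMatrix b b (ad k g x)).map (C : k →+* k[X]) +
        (X : k[X]) • (LinearMap.toMatrix b b (ad k g v)).map (C : k →+* k[X])).charpoly).map
          (aeval (R := k) t : k[X] →ₐ[k] A).toRingHom := by
  obtain ⟨φ, z, hz, w, hw⟩ := aux_iter (A := A) (k := k) x v hx t N htN N
  rw [pow_succ, htN, zero_mul, zero_smul, add_zero] at hw
  have hker : ∀ q ∈ (LinearMap.ker (ad k g x)).baseChange A, ∀ j ∈ s,
      ⁅q, (1 : A) ⊗ₜ[k] b j⁆ = 0 := by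
    intro q hq j hj
    rw [Submodule.baseChange_eq_span] at hq
    induction hq using Submodule.span_induction with
    | mem q h =>
      obtain ⟨q, hq, rfl⟩ := h
      have : ⁅q, b j⁆ = 0 := hc q (by simpa using hq) _ hj
      simp [this]
    | zero => simp
    | add q q' _ _ h h' => simp [h, h']
    | smul a q _ h => simp [h]
  have hmem : (1 : A) ⊗ₜ[k] x + t • z ∈ (LinearMap.ker (ad k g x)).baseChange A :=
    add_mem (Submodule.tmul_mem_baseChange_of_mem _ (by simp)) (Submodule.smul_mem _ _ hz)
  have h1 := aux_charpoly (b.baseChange A) (ad A (A ⊗[k] g) (1 ⊗ₜ x + t • z)) s (by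
      intro j hj
      simpa using hker _ hmem j hj)
  rw [← aux_matrix b x v t]
  rwa [← hw, ← LieAlgebra.conj_ad_apply, LinearEquiv.charpoly_conj] at h1

open Polynomial in
lemma aux_dense [CharZero k] (c : Submodule k g) (x : g)
    (hx : ∀ w : g, ∃ z u : g, ⁅x, z⁆ = 0 ∧ w = z + ⁅u, x⁆)
    (hc : ∀ w : g, ⁅x, w⁆ = 0 → ∀ y ∈ c, ⁅w, y⁆ = 0) (y : g) :
    finrank k c ≤ finrank k (LieSubalgebra.engel k y) := by
  classical
  obtain ⟨d, hd⟩ := Submodule.exists_isCompl c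
  let b : Basis _ k g := ((finBasis k c).prod (finBasis k d)).map (Submodule.prodEquivOfIsCompl c d hd)
  have hb : ∀ i, b (Sum.inl i) ∈ c := by
    intro i
    simp [b]
  set v := y - x with hv
  set P := ((LinearMap.toMatrix b b (ad k g x)).map (C : k →+* k[X]) +
        (X : k[X]) • (LinearMap.toMatrix b b (ad k g v)).map (C : k →+* k[X])).charpoly with hP
  have key : ∀ i < finrank k c, P.coeff i = 0 := by
    intro i hi
    by_contra hne
    obtain ⟨N, hN⟩ : ∃ N, N = (P.coeff i).natDegree + 1 := ⟨_, rfl⟩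
    have hnt : Nontrivial (AdjoinRoot (X ^ N : k[X])) := 
      AdjoinRoot.nontrivial _ (by
        rw [degree_X_pow]
        exact_mod_cast (by omega : N ≠ 0))
    let _ : Algebra ℚ (AdjoinRoot (X ^ N : k[X])) := ((algebraMap k _).comp (algebraMap ℚ k)).toAlgebra
    have htN : (AdjoinRoot.root (X ^ N : k[X])) ^ N = 0 := by
      have := AdjoinRoot.eval₂_root (X ^ N : k[X])
      simpa using this
    have h1 := aux_gen b x v (Finset.univ.image Sum.inl) hx (by
      intro w hw j hj
      simp only [Finset.mem_image, Finset.mem_univ, true_and] at hj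
      obtain ⟨j, rfl⟩ := hj
      exact hc w hw _ (hb j)) (AdjoinRoot.root (X ^ N : k[X])) N htN
    rw [Finset.card_image_of_injective _ Sum.inl_injective, Finset.card_univ, Fintype.card_fin,
      ← hP, X_pow_dvd_iff] at h1
    have h3 := h1 i hi
    rw [coeff_map] at h3
    change aeval _ (P.coeff i) = 0 at h3
    rw [AdjoinRoot.aeval_eq, AdjoinRoot.mk_eq_zero] at h3
    have := natDegree_le_of_dvd h3 hne
    rw [natDegree_X_pow] at this
    omega
  have h4 : (ad k g y).charpoly = P.map (aeval (R := k) (1 : k) : k[X] →ₐ[k] k).toRingHom := by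
    rw [hP, ← LinearMap.charpoly_toMatrix _ b, ← Matrix.charpoly_map]
    congr 1
    have : y = x + v := by rw [hv]; abel
    rw [this, map_add, map_add]
    ext i j
    simp [Matrix.map_apply]
  rw [LieAlgebra.finrank_engel]
  apply le_natTrailingDegree (LinearMap.charpoly_monic _).ne_zero
  intro i hi
  rw [h4, coeff_map, key i hi, map_zero]
end

section
variable {k : Type*} [Field k] [IsAlgClosed k] {V : Type*} [AddCommGroup V] [Module k V] [FiniteDimensional k V]

lemma aux_ker {A B : Module.End k V} (hAB : Commute A B) (hB : B.IsSemisimple) :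
    ∃ s : k, LinearMap.ker (A + s • B) ≤ LinearMap.ker A ⊓ LinearMap.ker B := by
  classical
  have hinf : Infinite k := IsAlgClosed.instInfinite
  have hfin : (Set.image2 (fun l m : k => -(l / m)) {l | A.HasEigenvalue l} {m | B.HasEigenvalue m}).Finite :=
    Set.Finite.image2 _ (Module.End.finite_hasEigenvalue A) (Module.End.finite_hasEigenvalue B)
  obtain ⟨s, hs⟩ := hfin.exists_notMem
  refine ⟨s, ?_⟩
  set W := LinearMap.ker (A + s • B) with hW
  have hWm : ∀ w, w ∈ W ↔ A w = - (s • B w) := by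
    intro w
    simp [W, add_eq_zero_iff_eq_neg]
  have hBW : ∀ x ∈ W, B x ∈ W := by
    intro x hx
    rw [hWm] at hx ⊢
    have : A (B x) = B (A x) := LinearMap.congr_fun hAB.eq x
    rw [this, hx]; simp
  have hWB : W ≤ LinearMap.ker B := by
    have h1 := Submodule.inf_iSup_genEigenspace (p := W) (f := B) hBW ⊤
    have h2 : ∀ μ, B.genEigenspace μ ⊤ = B.eigenspace μ := fun μ =>
      hB.isFinitelySemisimple.genEigenspace_eq_eigenspace μ ENat.top_pos
    have h3 : ⨆ μ, B.genEigenspace μ ⊤ = ⊤ := Module.End.iSup_maxGenEigenspace_eq_top B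
    rw [h3, inf_top_eq] at h1
    rw [h1]
    refine iSup_le fun μ => ?_
    rw [h2]
    rintro w ⟨hw, hw2⟩
    rw [LinearMap.mem_ker]
    have hw2 : B w = μ • w := Module.End.mem_eigenspace_iff.mp hw2
    by_cases hμ : μ = 0
    · rw [hw2, hμ, zero_smul]
    by_cases hw0 : w = 0
    · rw [hw0, map_zero]
    exfalso
    apply hs
    have hAw : A w = (-(s * μ)) • w := by
      rw [(hWm w).mp hw, hw2, smul_smul, neg_smul]
    refine ⟨-(s * μ), Module.End.hasEigenvalue_of_hasEigenvector (x := w) ⟨Module.End.mem_eigenspace_iff.mpr hAw, hw0⟩, μ,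
      Module.End.hasEigenvalue_of_hasEigenvector (x := w) ⟨Module.End.mem_eigenspace_iff.mpr hw2, hw0⟩, ?_⟩
    field_simp
  intro w hw
  have h0 : B w = 0 := hWB hw
  refine ⟨?_, h0⟩
  have := (hWm w).mp hw
  rw [h0] at this
  simpa using this

lemma aux_ker_sq {f : Module.End k V} (hf : f.IsSemisimple) {v : V} (h : f (f v) = 0) : f v = 0 := by
  have h2 := hf.isFinitelySemisimple.genEigenspace_eq_eigenspace 0 (k := ((2 : ℕ) : ℕ∞)) (by norm_num)
  have : v ∈ f.genEigenspace 0 ((2 : ℕ) : ℕ∞) := by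
    rw [Module.End.mem_genEigenspace_nat]
    simp [pow_two, h]
  rw [h2, Module.End.mem_eigenspace_iff] at this
  simpa using this

lemma aux_finrank_le (f : Module.End k V) (P Q : Submodule k V) (hP : P.map f ≤ Q)
    (hsq : ∀ v, f (f v) = 0 → f v = 0) :
    finrank k (P.map f) ≤ finrank k (Q.map f) := by
  have hinj : Function.Injective (f.domRestrict (P.map f)) := by
    rw [← LinearMap.ker_eq_bot, Submodule.eq_bot_iff]
    rintro ⟨_, v, hv, rfl⟩ h
    simp at h
    simp [hsq v h]
  have h1 := LinearMap.finrank_range_of_inj hinj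
  rw [LinearMap.range_domRestrict] at h1
  rw [← h1]
  exact Submodule.finrank_mono (Submodule.map_mono hP)

lemma aux_rank_nullity (f : Module.End k V) (P : Submodule k V) :
    finrank k (P.map f) + finrank k (P ⊓ LinearMap.ker f : Submodule k V) = finrank k P := by
  have h := LinearMap.finrank_range_add_finrank_ker (f.domRestrict P)
  rw [LinearMap.range_domRestrict, LinearMap.ker_domRestrict, ← Submodule.finrank_map_subtype_eq,
    Submodule.map_comap_subtype] at h
  exact h

lemma aux_count (f : Module.End k V) (P Q : Submodule k V) (hP : P.map f ≤ Q) (hQ : Q.map f ≤ P)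
    (hf : f.IsSemisimple) :
    finrank k P + finrank k (Q ⊓ LinearMap.ker f : Submodule k V) =
      finrank k Q + finrank k (P ⊓ LinearMap.ker f : Submodule k V) := by
  have h1 := aux_finrank_le f P Q hP (fun v => aux_ker_sq hf)
  have h2 := aux_finrank_le f Q P hQ (fun v => aux_ker_sq hf)
  have h3 := aux_rank_nullity f P
  have h4 := aux_rank_nullity f Q
  omega

lemma aux_dec {f : Module.End k V} (hf : f.IsSemisimple) (w : V) :
    ∃ z u, f z = 0 ∧ w = z + f u := by
  have hd : Disjoint (LinearMap.ker f) (LinearMap.range f) := by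
    rw [Submodule.disjoint_def]
    rintro _ h ⟨v, rfl⟩
    exact aux_ker_sq hf h
  have hc := Submodule.eq_top_of_disjoint _ _ (by
    have := LinearMap.finrank_range_add_finrank_ker f; omega) hd
  have : w ∈ LinearMap.ker f ⊔ LinearMap.range f := hc ▸ Submodule.mem_top
  obtain ⟨z, hz, _, ⟨u, rfl⟩, rfl⟩ := Submodule.mem_sup.mp this
  exact ⟨z, u, hz, rfl⟩
end

section
variable {k : Type*} [Field k] [IsAlgClosed k] [CharZero k] {g : Type*} [LieRing g] [LieAlgebra k g] [FiniteDimensional k g]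

lemma aux_commute {a b : g} (h : ⁅a, b⁆ = 0) : Commute (ad k g a) (ad k g b) := by
  refine LinearMap.ext fun w => ?_
  have := leibniz_lie a b w
  rw [h, zero_lie, zero_add] at this
  simpa using this

lemma aux_generic (c : Submodule k g) (hs : ∀ x ∈ c, (ad k g x).IsSemisimple)
    (hc : ∀ x ∈ c, ∀ y ∈ c, ⁅x, y⁆ = 0) :
    ∃ x ∈ c, ∀ w : g, ⁅x, w⁆ = 0 → ∀ y ∈ c, ⁅y, w⁆ = 0 := by
  classical
  let p : ℕ → Prop := fun n => ∃ x ∈ c, finrank k (LinearMap.ker (ad k g x)) = n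
  have hp : ∃ n, p n := ⟨_, 0, c.zero_mem, rfl⟩
  obtain ⟨x, hx, hxn⟩ := Nat.find_spec hp
  refine ⟨x, hx, fun w hw y hy => ?_⟩
  have hcomm : Commute (ad k g x) (ad k g y) := by
    exact aux_commute (hc x hx y hy)
  obtain ⟨s, hle⟩ := aux_ker hcomm (hs y hy)
  have h1 : ad k g x + s • ad k g y = ad k g (x + s • y) := by simp
  rw [h1] at hle
  have h2 : Nat.find hp ≤ finrank k (LinearMap.ker (ad k g (x + s • y))) :=
    Nat.find_min' hp ⟨_, c.add_mem hx (c.smul_mem s hy), rfl⟩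
  have h3 := Submodule.finrank_mono hle
  have h4 := Submodule.eq_of_le_of_finrank_le (inf_le_left : LinearMap.ker (ad k g x) ⊓ LinearMap.ker (ad k g y) ≤ _) (by omega)
  have h5 : w ∈ LinearMap.ker (ad k g x) := by simpa using hw
  rw [← h4] at h5
  simpa using h5.2

variable [LieAlgebra.IsKilling k g]

lemma aux_cartan_self (H : LieSubalgebra k g) [H.IsCartanSubalgebra] (w : g)
    (hw : ∀ y ∈ H, ⁅y, w⁆ = 0) : w ∈ H := by
  suffices w ∈ H.normalizer by rwa [LieSubalgebra.IsCartanSubalgebra.self_normalizing] at this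
  refine (H.mem_normalizer_iff w).mpr fun z hz => ?_
  rw [← lie_skew, hw z hz, neg_zero]
  exact H.zero_mem

lemma aux_cartan_comm (H : LieSubalgebra k g) [H.IsCartanSubalgebra] :
    ∀ x ∈ H, ∀ y ∈ H, ⁅x, y⁆ = 0 := by
  intro x hx y hy
  have := LieModule.IsTrivial.trivial (⟨x, hx⟩ : H) (⟨y, hy⟩ : H)
  simpa using congrArg Subtype.val this

lemma aux_rank (H : LieSubalgebra k g) [H.IsCartanSubalgebra] (c : Submodule k g)
    (hs : ∀ x ∈ c, (ad k g x).IsSemisimple)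
    (hc : ∀ x ∈ c, ∀ y ∈ c, ⁅x, y⁆ = 0) : finrank k c ≤ finrank k H := by
  have hHs : ∀ x ∈ H.toSubmodule, (ad k g x).IsSemisimple := fun x hx =>
    LieAlgebra.IsKilling.isSemisimple_ad_of_mem_isCartanSubalgebra (H := H) hx
  obtain ⟨y, hy, hyg⟩ := aux_generic H.toSubmodule hHs (aux_cartan_comm H)
  obtain ⟨x, hx, hxg⟩ := aux_generic c hs hc
  have h1 := aux_dense c x (fun w => by
    obtain ⟨z, u, hz, hw⟩ := aux_dec (hs x hx) w
    exact ⟨z, -u, by simpa using hz, by rw [hw]; simp⟩)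
    (fun w hw y hy => by rw [← lie_skew, hxg w hw y hy, neg_zero]) y
  refine h1.trans ?_
  apply Submodule.finrank_mono (s := (LieSubalgebra.engel k y).toSubmodule) (t := H.toSubmodule)
  intro w hw
  have h2 : w ∈ (ad k g y).maxGenEigenspace 0 := hw
  rw [(hHs y hy).isFinitelySemisimple.maxGenEigenspace_eq_eigenspace, Module.End.mem_eigenspace_iff, zero_smul] at h2
  exact aux_cartan_self H w (hyg w h2)

lemma aux_jordan (y : g) : ∃ s n : g, y = n + s ∧ (ad k g s).IsSemisimple ∧ IsNilpotent (ad k g n) ∧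
    (∀ w : g, ⁅y, w⁆ = 0 → ⁅s, w⁆ = 0) := by
  obtain ⟨N, hN₀, S, hS₀, hN, hS, hSN⟩ := (ad k g y).exists_isNilpotent_isSemisimple
  have hSc : Commute (ad k g y) S := Algebra.commute_of_mem_adjoin_self hS₀
  have hN' := hN
  rw [eq_sub_of_add_eq hSN.symm] at hN
  have aux {α : k} {z : g} (hz : z ∈ (ad k g y).maxGenEigenspace α) : S z = α • z := by
    rw [Module.End.maxGenEigenspace_eq] at hz
    rw [Module.End.apply_eq_of_mem_of_comm_of_isFinitelySemisimple_of_isNil hz hSc hS.isFinitelySemisimple hN]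
  have h_der1 (z w : g) (α β : k) (hz : z ∈ (ad k g y).maxGenEigenspace α) (hw : w ∈ (ad k g y).maxGenEigenspace β) :
      S ⁅z, w⁆ = ⁅S z, w⁆ + ⁅z, S w⁆ := by
    have hzw : ⁅z, w⁆ ∈ (ad k g y).maxGenEigenspace (α + β) :=
      LieModule.lie_mem_maxGenEigenspace_toEnd hz hw
    rw [aux hz, aux hw, aux hzw, smul_lie, lie_smul, ← add_smul]
  have htop := Module.End.iSup_maxGenEigenspace_eq_top (ad k g y)
  have h_der (z w : g) : S ⁅z, w⁆ = ⁅S z, w⁆ + ⁅z, S w⁆ := by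
    have hz : z ∈ ⨆ α : k, (ad k g y).maxGenEigenspace α := by rw [htop]; trivial
    have hw : w ∈ ⨆ α : k, (ad k g y).maxGenEigenspace α := by rw [htop]; trivial
    induction hz using Submodule.iSup_induction' with
    | mem α z hz =>
      induction hw using Submodule.iSup_induction' with
      | mem β w hw => exact h_der1 z w α β hz hw
      | zero => simp
      | add _ _ _ _ h h' => simp only [lie_add, map_add, h, h']; abel
    | zero => simp
    | add _ _ _ _ h h' => simp only [add_lie, map_add, h, h']; abel
  have h_der' : ∀ y z : g, S ⁅y, z⁆ = ⁅y, S z⁆ - ⁅z, S y⁆ := by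
    intro a b
    rw [h_der, ← lie_skew b (S a)]; abel
  let S' : LieDerivation k g g := ⟨S, h_der'⟩
  obtain ⟨s, hs⟩ := LieDerivation.IsKilling.exists_eq_ad S'
  have hsS : ad k g s = S := by
    rw [← LieDerivation.coe_ad_apply_eq_ad_apply s, hs]
  refine ⟨s, y - s, by abel, hsS ▸ hS, ?_, ?_⟩
  · rw [map_sub, hsS]; exact hN
  · intro w hw
    have : S w = (0 : k) • w := aux (by
      rw [Module.End.mem_maxGenEigenspace]
      exact ⟨1, by simpa using hw⟩)
    rw [← hsS] at this
    simpa using this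

lemma aux_jordan_unique {s n s' n' : g} (h : n + s = n' + s') (hs : (ad k g s).IsSemisimple)
    (hn : IsNilpotent (ad k g n)) (hs' : (ad k g s').IsSemisimple)
    (hn' : IsNilpotent (ad k g n')) (hc : ⁅n, s⁆ = 0) (hc' : ⁅n', s'⁆ = 0) : s = s' := by
  have hcomm : ∀ a b : g, ⁅a, b⁆ = 0 → Commute (ad k g a) (ad k g b) := fun a b => aux_commute
  have := (Module.End.isNilpotent_isSemisimple_unique hn hs hn' hs' (hcomm _ _ hc) (hcomm _ _ hc')
    (by rw [← map_add, ← map_add, h])).2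
  have h0 : LieDerivation.ad k g (s - s') = 0 := by
    ext w
    have := LinearMap.congr_fun this w
    simp only [LieAlgebra.ad_apply] at this
    simp [this]
  rw [LieDerivation.IsKilling.ad_apply_eq_zero_iff] at h0
  exact sub_eq_zero.mp h0

lemma aux_jordan_equiv (σ : g ≃ₗ⁅k⁆ g) (e : k) {s n : g} (hs : (ad k g s).IsSemisimple)
    (hn : IsNilpotent (ad k g n)) (hc : ⁅n, s⁆ = 0) (h : σ (n + s) = e • (n + s)) : σ s = e • s := by
  have h1 : (ad k g (σ s)).IsSemisimple := by
    refine (LinearEquiv.isSemisimple_iff (ad k g s) (ad k g (σ s)) σ.toLinearEquiv ?_).mp hs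
    ext y; simp; exact LieEquiv.map_lie σ s y
  have h2 : IsNilpotent (ad k g (σ n)) := by
    rw [← LieAlgebra.conj_ad_apply]
    exact hn.map (σ.toLinearEquiv.conjAlgEquiv k)
  refine aux_jordan_unique (n := σ n) (n' := e • n) (k := k) ?_ h1 h2 ?_ ?_ ?_ ?_
  · rw [← map_add, h, smul_add]
  · rw [map_smul]; exact Module.End.IsSemisimple_smul e hs
  · rw [map_smul]; exact hn.smul e
  · rw [← LieEquiv.map_lie, hc]; simp
  · simp [hc]
end

lemma mem_eig (σ : g ≃ₗ⁅k⁆ g) (e : k) (x : g) : x ∈ eigSub k g σ e ↔ σ x = e • x := by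
  unfold eigSub
  rw [Module.End.mem_eigenspace_iff]; rfl

lemma aux_N (σ₁ σ₂ : g ≃ₗ⁅k⁆ g) (hσ : CommutingInvolutions k g σ₁ σ₂) (e₁ e₂ : k)
    (he₁ : e₁ * e₁ = 1) (he₂ : e₂ * e₂ = 1) (x n : g) (hxs : IsSSElt k g x)
    (hx : x ∈ eigSub k g σ₁ e₁ ⊓ eigSub k g σ₂ e₂) (hn : n ∈ eigSub k g σ₁ e₁ ⊓ eigSub k g σ₂ e₂)
    (hxn : ⁅x, n⁆ = 0)
    (hk : ∀ w ∈ eigSub k g σ₁ e₁ ⊓ eigSub k g σ₂ e₂, ⁅x, w⁆ = 0 → killingForm k g n w = 0) :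
    n = 0 := by
  obtain ⟨i₁, i₂, hc⟩ := hσ
  simp only [Submodule.mem_inf, mem_eig] at hx hn hk
  have hinv : ∀ (σ : g ≃ₗ⁅k⁆ g) (e : k), IsInvolution k g σ → σ n = e • n →
      ∀ w, killingForm k g n (σ w) = e * killingForm k g n w := by
    intro σ e hi h w
    rw [← LieAlgebra.killingForm_of_equiv_apply σ n (σ w), h, hi]; simp
  have hz0 : ∀ (σ : g ≃ₗ⁅k⁆ g) (e : k), e * e = 1 → σ x = e • x →
      ∀ w, ⁅x, w⁆ = 0 → ⁅x, σ w⁆ = 0 := by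
    intro σ e he h w hw
    have : σ ⁅x, w⁆ = e • ⁅x, σ w⁆ := by rw [LieEquiv.map_lie, h, smul_lie]
    rw [hw, map_zero] at this
    have h2 := congrArg (fun t => e • t) this
    simpa [smul_smul, he] using h2.symm
  have key : ∀ w, killingForm k g n w = 0 := by
    intro w
    obtain ⟨z, u, hz, rfl⟩ := aux_dec hxs w
    rw [LieAlgebra.ad_apply] at hz ⊢
    have h1 : killingForm k g n ⁅x, u⁆ = 0 := by
      rw [← LieModule.traceForm_apply_lie_apply, ← lie_skew, hxn]; simp
    rw [map_add, h1, add_zero]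
    have h2 := hk ((z + e₁ • σ₁ z) + e₂ • σ₂ (z + e₁ • σ₁ z)) (by
      have a1 := i₁ z
      have a2 := i₂ z
      have a3 : σ₁ (σ₂ (σ₁ z)) = σ₂ z := by rw [hc, i₁]
      have a4 := hc z
      have a5 := i₂ (σ₁ z)
      constructor
      · simp only [map_add, map_smul, smul_add, smul_smul, a1, a3, a4]
        simp only [he₁, ← mul_assoc, one_smul, one_mul, mul_comm e₂ e₁]; abel
      · simp only [map_add, map_smul, smul_add, smul_smul, a2, a5]
        simp only [he₂, ← mul_assoc, one_smul, one_mul]; abel) (by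
      have b1 := hz0 σ₁ e₁ he₁ hx.1 z hz
      have b2 := hz0 σ₂ e₂ he₂ hx.2 z hz
      have b3 := hz0 σ₂ e₂ he₂ hx.2 _ b1
      simp [hz, b1, b2, b3])
    simp only [map_add, map_smul, hinv σ₁ e₁ i₁ hn.1, hinv σ₂ e₂ i₂ hn.2, smul_eq_mul] at h2
    have h3 : (4 : k) * killingForm k g n z = 0 := by
      linear_combination h2 - (1 + e₂ * e₂) * killingForm k g n z * he₁ - 2 * killingForm k g n z * he₂
    rcases mul_eq_zero.mp h3 with h | h
    · norm_num at h
    · exact h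
  exact (LieAlgebra.IsKilling.killingForm_nondegenerate k g).1 n key

lemma aux_insert (c : Submodule k g) (hs : ∀ x ∈ c, IsSSElt k g x)
    (hc : ∀ x ∈ c, ∀ y ∈ c, ⁅x, y⁆ = 0) (s : g) (hss : IsSSElt k g s) (hsc : ∀ x ∈ c, ⁅x, s⁆ = 0) :
    (∀ x ∈ c ⊔ Submodule.span k {s}, IsSSElt k g x) ∧
    (∀ x ∈ c ⊔ Submodule.span k {s}, ∀ y ∈ c ⊔ Submodule.span k {s}, ⁅x, y⁆ = 0) := by
  have hsc' : ∀ x ∈ c, ⁅s, x⁆ = 0 := fun x hx => by rw [← lie_skew, hsc x hx, neg_zero]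
  constructor
  · intro x hx
    obtain ⟨y, hy, z, hz, rfl⟩ := Submodule.mem_sup.mp hx
    obtain ⟨t, rfl⟩ := Submodule.mem_span_singleton.mp hz
    unfold IsSSElt
    rw [map_add]
    refine Module.End.IsSemisimple.add_of_commute (aux_commute (by simp [hsc y hy])) (hs y hy) ?_
    rw [map_smul]
    exact Module.End.IsSemisimple_smul t hss
  · intro x hx x' hx'
    obtain ⟨y, hy, z, hz, rfl⟩ := Submodule.mem_sup.mp hx
    obtain ⟨t, rfl⟩ := Submodule.mem_span_singleton.mp hz
    obtain ⟨y', hy', z', hz', rfl⟩ := Submodule.mem_sup.mp hx'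
    obtain ⟨t', rfl⟩ := Submodule.mem_span_singleton.mp hz'
    simp [hsc y hy, hsc' y' hy', hc y hy y' hy']

lemma aux_kil (n s : g) (hn : IsNilpElt k g n) (h : ⁅n, s⁆ = 0) : killingForm k g n s = 0 := by
  rw [LieModule.traceForm_apply_apply]
  exact (LinearMap.isNilpotent_trace_of_isNilpotent ((aux_commute h).isNilpotent_mul_right hn)).eq_zero

lemma aux_B (σ₁ σ₂ : g ≃ₗ⁅k⁆ g) (hσ : CommutingInvolutions k g σ₁ σ₂) (e₁ e₂ : k)
    (he₁ : e₁ * e₁ = 1) (he₂ : e₂ * e₂ = 1) (c : Submodule k g)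
    (hC : IsCartanSubspace k g (eigSub k g σ₁ e₁ ⊓ eigSub k g σ₂ e₂) c)
    (y : g) (hy : y ∈ eigSub k g σ₁ e₁ ⊓ eigSub k g σ₂ e₂) (hyc : ∀ x ∈ c, ⁅x, y⁆ = 0) : y ∈ c := by
  obtain ⟨hcm, hs, hc, hmax⟩ := hC
  set m := eigSub k g σ₁ e₁ ⊓ eigSub k g σ₂ e₂ with hm
  have hJ : ∀ y ∈ m, (∀ x ∈ c, ⁅x, y⁆ = 0) → ∃ s ∈ c, ∃ n ∈ m, y = n + s ∧ IsNilpElt k g n ∧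
      (∀ x ∈ c, ⁅x, n⁆ = 0) := by
    intro y hy hyc
    obtain ⟨s, n, rfl, hss, hnn, hcen⟩ := aux_jordan (k := k) y
    have hsn : ⁅n, s⁆ = 0 := by
      have := hcen (n + s) (lie_self _)
      rw [lie_add, lie_self, add_zero] at this
      rw [← lie_skew, this, neg_zero]
    have hsc : ∀ x ∈ c, ⁅x, s⁆ = 0 := by
      intro x hx
      rw [← lie_skew, hcen x (by rw [← lie_skew, hyc x hx, neg_zero]), neg_zero]
    have hsm : s ∈ m := by
      simp only [hm, Submodule.mem_inf, mem_eig] at hy ⊢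
      exact ⟨aux_jordan_equiv σ₁ e₁ hss hnn hsn hy.1, aux_jordan_equiv σ₂ e₂ hss hnn hsn hy.2⟩
    obtain ⟨t1, t2⟩ := aux_insert k g c hs hc s hss hsc
    have h := hmax _ (sup_le hcm (by simpa using hsm)) t1 t2 le_sup_left
    have hsC : s ∈ c := by
      rw [← h]; exact Submodule.mem_sup_right (Submodule.mem_span_singleton_self s)
    refine ⟨s, hsC, n, by simpa using m.sub_mem hy hsm, rfl, hnn, fun x hx => ?_⟩
    have := hyc x hx
    rwa [lie_add, hsc x hx, add_zero] at this
  obtain ⟨s, hsc, n, hnm, rfl, hnn, hnc⟩ := hJ y hy hyc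
  obtain ⟨x, hx, hxg⟩ := aux_generic c hs hc
  have hsymm : ∀ a b, killingForm k g a b = killingForm k g b a := LieModule.traceForm_comm k g g
  have hskew : ∀ {a b : g}, ⁅a, b⁆ = 0 → ⁅b, a⁆ = 0 := fun {a b} h => by rw [← lie_skew, h, neg_zero]
  have hn0 : n = 0 := by
    refine aux_N k g σ₁ σ₂ hσ e₁ e₂ he₁ he₂ x n (hs x hx) (hcm hx) hnm (hnc x hx) ?_
    intro w hw hxw
    obtain ⟨s', hs', n', hn'm, rfl, hn', hn'c⟩ := hJ w hw (hxg w hxw)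
    obtain ⟨s2, hs2, n2, hn2m, h2, hn2, hn2c⟩ := hJ (n + n') (m.add_mem hnm hn'm) (fun x hx => by
      rw [lie_add, hnc x hx, hn'c x hx, add_zero])
    have k1 : ∀ t ∈ c, killingForm k g n t = 0 := fun t ht => aux_kil k g n t hnn (hskew (hnc t ht))
    have k2 : ∀ t ∈ c, killingForm k g n' t = 0 := fun t ht => aux_kil k g n' t hn' (hskew (hn'c t ht))
    have k3 : ∀ t ∈ c, killingForm k g n2 t = 0 := fun t ht => aux_kil k g n2 t hn2 (hskew (hn2c t ht))
    have k4 := aux_kil k g n n hnn (lie_self _)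
    have k5 := aux_kil k g n' n' hn' (lie_self _)
    have k6 := aux_kil k g n2 n2 hn2 (lie_self _)
    have k7 : killingForm k g s2 s2 = 0 := by
      have : killingForm k g (n + n') s2 = 0 := by simp [k1 s2 hs2, k2 s2 hs2]
      rw [h2] at this
      simpa [k3 s2 hs2] using this
    have k8 : killingForm k g (n + n') (n + n') = 0 := by
      rw [h2]; simp [k6, k7, k3 s2 hs2, hsymm s2 n2]
    have k9 : 2 * killingForm k g n n' = 0 := by
      simp only [map_add, LinearMap.add_apply, k4, k5, hsymm n' n] at k8
      linear_combination k8
    rw [map_add, k1 s' hs', add_zero]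
    simpa using k9
  rw [hn0, zero_add]; exact hsc

lemma aux_extend (m c : Submodule k g) (hcm : c ≤ m) (hs : ∀ x ∈ c, IsSSElt k g x)
    (hc : ∀ x ∈ c, ∀ y ∈ c, ⁅x, y⁆ = 0) : ∃ b, c ≤ b ∧ IsCartanSubspace k g m b := by
  let S : Set (Submodule k g) := {b | c ≤ b ∧ b ≤ m ∧ (∀ x ∈ b, IsSSElt k g x) ∧ ∀ x ∈ b, ∀ y ∈ b, ⁅x, y⁆ = 0}
  have hne : S.Nonempty := ⟨c, le_rfl, hcm, hs, hc⟩
  obtain ⟨b, ⟨h1, h2, h3, h4⟩, hb⟩ := (wellFounded_gt (α := Submodule k g)).has_min S hne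
  refine ⟨b, h1, h2, h3, h4, fun c' g1 g2 g3 g4 => ?_⟩
  by_contra hne
  exact hb c' ⟨h1.trans g4, g1, g2, g3⟩ (lt_of_le_of_ne g4 (Ne.symm hne))

/-- Count for a toral subspace. -/
lemma aux_cnt (σ : g ≃ₗ⁅k⁆ g) (x : g) (hx : x ∈ eigSub k g σ (-1)) (hxs : IsSSElt k g x) :
    finrank k (eigSub k g σ 1) + finrank k (eigSub k g σ (-1) ⊓ LinearMap.ker (ad k g x) : Submodule k g) =
    finrank k (eigSub k g σ (-1)) + finrank k (eigSub k g σ 1 ⊓ LinearMap.ker (ad k g x) : Submodule k g) := by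
  rw [mem_eig] at hx
  apply aux_count _ _ _ ?_ ?_ hxs
  · rintro _ ⟨w, hw, rfl⟩
    have hw : w ∈ eigSub k g σ 1 := hw
    rw [mem_eig] at hw ⊢
    simp [LieEquiv.map_lie, hx, hw]
  · rintro _ ⟨w, hw, rfl⟩
    have hw : w ∈ eigSub k g σ (-1) := hw
    rw [mem_eig] at hw ⊢
    simp [LieEquiv.map_lie, hx, hw]

lemma aux_pm (σ : g ≃ₗ⁅k⁆ g) (x : g) (h1 : x ∈ eigSub k g σ 1) (h2 : x ∈ eigSub k g σ (-1)) : x = 0 := by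
  rw [mem_eig] at h1 h2
  rw [h1] at h2
  have : (2 : k) • x = 0 := by
    rw [two_smul]; nth_rewrite 1 [← one_smul k x]; rw [h2]; simp
  simpa using this

/-- For max rank: difference equals the rank, for each semisimple element of the -1 part. -/
lemma aux_mr (σ : g ≃ₗ⁅k⁆ g) (h : IsMaxRank k g σ) : ∃ r : ℕ,
    (∀ c : Submodule k g, (∀ x ∈ c, IsSSElt k g x) → (∀ x ∈ c, ∀ y ∈ c, ⁅x, y⁆ = 0) → finrank k c ≤ r) ∧
    ∀ x ∈ eigSub k g σ (-1), IsSSElt k g x →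
      finrank k (eigSub k g σ (-1) ⊓ LinearMap.ker (ad k g x) : Submodule k g) =
        r + finrank k (eigSub k g σ 1 ⊓ LinearMap.ker (ad k g x) : Submodule k g) := by
  obtain ⟨H, hH, hle⟩ := h
  refine ⟨finrank k H, fun c hs hc => aux_rank H c hs hc, fun x hx hxs => ?_⟩
  have hHs : ∀ x ∈ H.toSubmodule, (ad k g x).IsSemisimple := fun x hx =>
    LieAlgebra.IsKilling.isSemisimple_ad_of_mem_isCartanSubalgebra (H := H) hx
  obtain ⟨y, hy, hyg⟩ := aux_generic H.toSubmodule hHs (aux_cartan_comm H)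
  have hker : LinearMap.ker (ad k g y) = H.toSubmodule := by
    ext w
    constructor
    · intro hw
      exact aux_cartan_self H w (hyg w (by simpa using hw))
    · intro hw
      have := aux_cartan_comm H y hy w hw
      simpa using this
  have e1 := aux_cnt k g σ y (hle hy) (hHs y hy)
  have e2 := aux_cnt k g σ x hx hxs
  have e3 : eigSub k g σ (-1) ⊓ LinearMap.ker (ad k g y) = H.toSubmodule := by
    rw [hker]; exact inf_eq_right.mpr hle
  have e4 : eigSub k g σ 1 ⊓ LinearMap.ker (ad k g y) = ⊥ := by
    rw [hker, Submodule.eq_bot_iff]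
    rintro w ⟨h1, h2⟩
    exact aux_pm k g σ w h1 (hle h2)
  rw [e3, e4, finrank_bot] at e1
  have e5 : finrank k H.toSubmodule = finrank k H := rfl
  omega

lemma aux_A (σ : g ≃ₗ⁅k⁆ g) (hi : IsInvolution k g σ) (h : IsMaxRank k g σ) (b : Submodule k g)
    (hb : IsCartanSubspace k g (eigSub k g σ (-1)) b) (a : g) (ha : a ∈ eigSub k g σ 1)
    (hab : ∀ u ∈ b, ⁅u, a⁆ = 0) : a = 0 := by
  obtain ⟨r, hr, hcount⟩ := aux_mr k g σ h
  have hB := aux_B k g σ σ ⟨hi, hi, fun _ => rfl⟩ (-1) (-1) (by ring) (by ring) b (by rwa [inf_idem])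
  rw [inf_idem] at hB
  obtain ⟨hbm, hs, hc, hmax⟩ := hb
  obtain ⟨x, hx, hxg⟩ := aux_generic b hs hc
  have e := hcount x (hbm hx) (hs x hx)
  have e1 : eigSub k g σ (-1) ⊓ LinearMap.ker (ad k g x) ≤ b := by
    rintro w ⟨h1, h2⟩
    exact hB w h1 (hxg w (by simpa using h2))
  have e2 := Submodule.finrank_mono e1
  have e3 := hr b hs hc
  have e4 : finrank k (eigSub k g σ 1 ⊓ LinearMap.ker (ad k g x) : Submodule k g) = 0 := by omega
  rw [Submodule.finrank_eq_zero] at e4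
  have : a ∈ eigSub k g σ 1 ⊓ LinearMap.ker (ad k g x) := ⟨ha, by simpa using hab x hx⟩
  rw [e4] at this
  simpa using this

/-- Splitting an eigenspace intersected with a centralizer. -/
lemma aux_split (σ τ : g ≃ₗ⁅k⁆ g) (hσ : CommutingInvolutions k g σ τ) (e f : k) (hf : f * f = 1)
    (x : g) (hx : x ∈ eigSub k g τ f) :
    finrank k (eigSub k g σ e ⊓ LinearMap.ker (ad k g x) : Submodule k g) =
      finrank k ((eigSub k g σ e ⊓ eigSub k g τ 1) ⊓ LinearMap.ker (ad k g x) : Submodule k g) +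
      finrank k ((eigSub k g σ e ⊓ eigSub k g τ (-1)) ⊓ LinearMap.ker (ad k g x) : Submodule k g) := by
  obtain ⟨i₁, i₂, hc⟩ := hσ
  rw [mem_eig] at hx
  rw [← Submodule.finrank_sup_add_finrank_inf_eq]
  have h0 : ((eigSub k g σ e ⊓ eigSub k g τ 1) ⊓ LinearMap.ker (ad k g x)) ⊓
      ((eigSub k g σ e ⊓ eigSub k g τ (-1)) ⊓ LinearMap.ker (ad k g x)) = ⊥ := by
    rw [Submodule.eq_bot_iff]
    rintro w ⟨⟨⟨_, h1⟩, _⟩, ⟨⟨_, h2⟩, _⟩⟩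
    exact aux_pm k g τ w h1 h2
  rw [h0, finrank_bot, add_zero]
  have aux : ∀ A B : Submodule k g, A = B → finrank k A = finrank k B := by rintro A _ rfl; rfl
  refine aux _ _ (le_antisymm ?_ ?_)
  · rintro w ⟨h1, h2⟩
    have h1 : w ∈ eigSub k g σ e := h1
    rw [mem_eig] at h1
    have h2 : ⁅x, w⁆ = 0 := by simpa using h2
    have h3 : ⁅x, τ w⁆ = 0 := by
      have : τ ⁅x, w⁆ = f • ⁅x, τ w⁆ := by rw [LieEquiv.map_lie, hx, smul_lie]
      rw [h2, map_zero] at this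
      have h2 := congrArg (fun t => f • t) this
      simpa [smul_smul, hf] using h2.symm
    have hτ := i₂ w
    have hw : w = (2⁻¹ : k) • (w + τ w) + (2⁻¹ : k) • (w - τ w) := by
      rw [← smul_add, add_add_sub_cancel, ← two_smul k w, smul_smul]; norm_num
    rw [hw]
    refine Submodule.add_mem_sup (Submodule.smul_mem _ _ ⟨⟨?_, ?_⟩, ?_⟩) (Submodule.smul_mem _ _ ⟨⟨?_, ?_⟩, ?_⟩)
    · refine (mem_eig k g _ _ _).mpr ?_
      rw [map_add, hc, h1, map_smul, smul_add]
    · refine (mem_eig k g _ _ _).mpr ?_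
      rw [map_add, hτ, one_smul, add_comm]
    · refine LinearMap.mem_ker.mpr ?_
      simp [h2, h3]
    · refine (mem_eig k g _ _ _).mpr ?_
      rw [map_sub, hc, h1, map_smul, smul_sub]
    · refine (mem_eig k g _ _ _).mpr ?_
      rw [map_sub, hτ, neg_one_smul, neg_sub]
    · refine LinearMap.mem_ker.mpr ?_
      simp [h2, h3]
  · exact sup_le (inf_le_inf_right _ inf_le_left) (inf_le_inf_right _ inf_le_left)

lemma aux_i (σ₁ σ₂ : g ≃ₗ⁅k⁆ g) (hσ : CommutingInvolutions k g σ₁ σ₂)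
    (h1 : IsMaxRank k g σ₁) (h2 : IsMaxRank k g σ₂) (c : Submodule k g)
    (hC : IsCartanSubspace k g (eigSub k g σ₁ (-1) ⊓ eigSub k g σ₂ (-1)) c)
    (c' : Submodule k g) (hs' : ∀ x ∈ c', IsSSElt k g x)
    (hc' : ∀ x ∈ c', ∀ y ∈ c', ⁅x, y⁆ = 0) (hle : c ≤ c') : c' = c := by
  have hB := aux_B k g σ₁ σ₂ hσ (-1) (-1) (by ring) (by ring) c hC
  obtain ⟨hcm, hs, hc, hmax⟩ := hC
  obtain ⟨x, hx, hxg⟩ := aux_generic c hs hc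
  obtain ⟨r₁, hr₁, hc₁⟩ := aux_mr k g σ₁ h1
  obtain ⟨r₂, hr₂, hc₂⟩ := aux_mr k g σ₂ h2
  have hσ' : CommutingInvolutions k g σ₂ σ₁ := ⟨hσ.2.1, hσ.1, fun x => (hσ.2.2 x).symm⟩
  have a1 := hc₁ x (hcm hx).1 (hs x hx)
  have a2 := hc₂ x (hcm hx).2 (hs x hx)
  rw [aux_split k g σ₁ σ₂ hσ _ (-1) (by ring) x (hcm hx).2,
    aux_split k g σ₁ σ₂ hσ _ (-1) (by ring) x (hcm hx).2] at a1
  rw [aux_split k g σ₂ σ₁ hσ' _ (-1) (by ring) x (hcm hx).1,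
    aux_split k g σ₂ σ₁ hσ' _ (-1) (by ring) x (hcm hx).1] at a2
  rw [inf_comm (eigSub k g σ₂ (-1)), inf_comm (eigSub k g σ₂ (-1)), inf_comm (eigSub k g σ₂ 1),
    inf_comm (eigSub k g σ₂ 1)] at a2
  have a3 : (eigSub k g σ₁ (-1) ⊓ eigSub k g σ₂ (-1)) ⊓ LinearMap.ker (ad k g x) ≤ c := by
    rintro w ⟨h1, h2⟩
    exact hB w h1 (hxg w (by simpa using h2))
  have a4 := Submodule.finrank_mono a3
  have a5 := hr₁ c' hs' hc'
  have a6 := hr₂ c' hs' hc'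
  exact (Submodule.eq_of_le_of_finrank_le hle (by omega)).symm

lemma aux_ii (σ₁ σ₂ : g ≃ₗ⁅k⁆ g) (hσ : CommutingInvolutions k g σ₁ σ₂)
    (h2 : IsMaxRank k g σ₂) (c : Submodule k g)
    (hC : IsCartanSubspace k g (eigSub k g σ₁ 1 ⊓ eigSub k g σ₂ (-1)) c) :
    IsCartanSubspace k g ((eigSub k g σ₁ (-1) ⊓ eigSub k g σ₂ 1) ⊔
      (eigSub k g σ₁ 1 ⊓ eigSub k g σ₂ (-1))) c := by
  have hB := aux_B k g σ₁ σ₂ hσ 1 (-1) (by ring) (by ring) c hC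
  obtain ⟨hcm, hs, hc, hmax⟩ := hC
  obtain ⟨x, hx, hxg⟩ := aux_generic c hs hc
  have hskew : ∀ {a b : g}, ⁅a, b⁆ = 0 → ⁅b, a⁆ = 0 := fun {a b} h => by rw [← lie_skew, h, neg_zero]
  have hbr : ∀ (σ : g ≃ₗ⁅k⁆ g) {e f : k} {a b : g}, a ∈ eigSub k g σ e → b ∈ eigSub k g σ f →
      ∀ e', e * f = e' → ⁅a, b⁆ ∈ eigSub k g σ e' := by
    rintro σ e f a b ha hb _ rfl
    rw [mem_eig] at ha hb ⊢
    rw [LieEquiv.map_lie, ha, hb, smul_lie, lie_smul, smul_smul]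
  refine ⟨hcm.trans le_sup_right, hs, hc, fun c' hm' hs' hc' hle => le_antisymm ?_ hle⟩
  intro w hw
  obtain ⟨a, ⟨ha1, ha2⟩, b, ⟨hb1, hb2⟩, rfl⟩ := Submodule.mem_sup.mp (hm' hw)
  have hab : ∀ y ∈ c, ⁅y, a⁆ = 0 ∧ ⁅y, b⁆ = 0 := by
    intro y hy
    have h := hc' y (hle hy) _ hw
    rw [lie_add] at h
    have p1 : ⁅y, a⁆ ∈ eigSub k g σ₁ (-1) := hbr σ₁ (hcm hy).1 ha1 _ (by ring)
    have p2 : ⁅y, b⁆ ∈ eigSub k g σ₁ 1 := hbr σ₁ (hcm hy).1 hb1 _ (by ring)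
    have p3 : ⁅y, b⁆ ∈ eigSub k g σ₁ (-1) := by
      rw [← neg_eq_of_add_eq_zero_right h]; exact Submodule.neg_mem _ p1
    have p4 := aux_pm k g σ₁ _ p2 p3
    rw [p4, add_zero] at h
    exact ⟨h, p4⟩
  have hbc : b ∈ c := hB b ⟨hb1, hb2⟩ fun y hy => (hab y hy).2
  obtain ⟨b', hcb', hb'⟩ := aux_extend k g (eigSub k g σ₂ (-1)) c (hcm.trans inf_le_right) hs hc
  have ha0 : a = 0 := by
    refine aux_A k g σ₂ hσ.2.1 h2 b' hb' a ha2 fun u hu => ?_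
    have hu2 := hb'.1 hu
    have hu2' := (mem_eig k g _ _ _).mp hu2
    have huc : ∀ y ∈ c, ⁅y, u⁆ = 0 := fun y hy => hb'.2.2.1 y (hcb' hy) u hu
    have huσc : ∀ y ∈ c, ⁅y, σ₁ u⁆ = 0 := by
      intro y hy
      have hy1 := (mem_eig k g _ _ _).mp (hcm hy).1
      rw [one_smul] at hy1
      have := congrArg σ₁ (huc y hy)
      rwa [LieEquiv.map_lie, hy1, map_zero] at this
    have hσu2 : σ₁ u ∈ eigSub k g σ₂ (-1) := by
      rw [mem_eig, ← hσ.2.2, hu2', map_smul]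
    have hi := hσ.1 u
    -- the two components, up to the factor two
    have hp : u + σ₁ u ∈ c := by
      refine hB _ ⟨(mem_eig k g _ _ _).mpr ?_, Submodule.add_mem _ hu2 hσu2⟩ fun y hy => ?_
      · rw [map_add, hi, one_smul, add_comm]
      · rw [lie_add, huc y hy, huσc y hy, add_zero]
    have hq1 : u - σ₁ u ∈ eigSub k g σ₁ (-1) := by
      rw [mem_eig, map_sub, hi, neg_one_smul, neg_sub]
    have hq2 : u - σ₁ u ∈ eigSub k g σ₂ (-1) := Submodule.sub_mem _ hu2 hσu2
    have hqc : ∀ y ∈ c, ⁅u - σ₁ u, y⁆ = 0 := fun y hy => hskew (by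
      rw [lie_sub, huc y hy, huσc y hy, sub_zero])
    have hpa : ⁅a, u + σ₁ u⁆ = 0 := hskew (hab _ hp).1
    have hec : ∀ y ∈ c, ⁅y, ⁅a, u - σ₁ u⁆⁆ = 0 := by
      intro y hy
      rw [leibniz_lie, (hab y hy).1, hskew (hqc y hy)]; simp
    have hqa : ⁅a, u - σ₁ u⁆ = 0 := by
      refine aux_N k g σ₁ σ₂ hσ 1 (-1) (by ring) (by ring) x _ (hs x hx) (hcm hx)
        ⟨hbr σ₁ ha1 hq1 _ (by ring), hbr σ₂ ha2 hq2 _ (by ring)⟩ (hec x hx) ?_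
      intro w hw hxw
      have hwc : w ∈ c := hB w hw (hxg w hxw)
      rw [LieModule.traceForm_apply_lie_apply, hqc w hwc, map_zero]
    have h4 : (2 : k) • ⁅a, u⁆ = 0 := by
      have : ⁅a, u + σ₁ u⁆ + ⁅a, u - σ₁ u⁆ = 0 := by rw [hpa, hqa, add_zero]
      rw [← lie_add, add_add_sub_cancel, ← two_smul k u, lie_smul] at this
      exact this
    exact hskew (by simpa using h4)
  rw [ha0, zero_add]; exact hbc

/-- If both `σ₁` and `σ₂` are of maximal rank, then:
(i) any Cartan subspace of `g₁₁` is a Cartan subspace of `g₁₀ ⊕ g₁₁` and of `g₀₁ ⊕ g₁₁`;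
(ii) any Cartan subspace of `g₀₁` is a Cartan subspace of `g₁₀ ⊕ g₀₁`;
(iii) any Cartan subspace of `g₁₀` is a Cartan subspace of `g₁₀ ⊕ g₀₁`. -/
theorem cartanSubspace_coincidences_of_both_maxRank (σ₁ σ₂ : g ≃ₗ⁅k⁆ g)
    (hcomm : CommutingInvolutions k g σ₁ σ₂)
    (h1 : IsMaxRank k g σ₁) (h2 : IsMaxRank k g σ₂) :
    (∀ c : Submodule k g, IsCartanSubspace k g (qSpace k g σ₁ σ₂ true true) c →
      IsCartanSubspace k g
          (qSpace k g σ₁ σ₂ true false ⊔ qSpace k g σ₁ σ₂ true true) c ∧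
        IsCartanSubspace k g
          (qSpace k g σ₁ σ₂ false true ⊔ qSpace k g σ₁ σ₂ true true) c) ∧
    (∀ c : Submodule k g, IsCartanSubspace k g (qSpace k g σ₁ σ₂ false true) c →
      IsCartanSubspace k g
        (qSpace k g σ₁ σ₂ true false ⊔ qSpace k g σ₁ σ₂ false true) c) ∧
    (∀ c : Submodule k g, IsCartanSubspace k g (qSpace k g σ₁ σ₂ true false) c →
      IsCartanSubspace k g
        (qSpace k g σ₁ σ₂ true false ⊔ qSpace k g σ₁ σ₂ false true) c) := by
  have hσ' : CommutingInvolutions k g σ₂ σ₁ := ⟨hcomm.2.1, hcomm.1, fun x => (hcomm.2.2 x).symm⟩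
  have e11 : qSpace k g σ₁ σ₂ true true = eigSub k g σ₁ (-1) ⊓ eigSub k g σ₂ (-1) := by simp [qSpace]
  have e10 : qSpace k g σ₁ σ₂ true false = eigSub k g σ₁ (-1) ⊓ eigSub k g σ₂ 1 := by simp [qSpace]
  have e01 : qSpace k g σ₁ σ₂ false true = eigSub k g σ₁ 1 ⊓ eigSub k g σ₂ (-1) := by simp [qSpace]
  rw [e11, e10, e01]
  refine ⟨fun c hC => ⟨?_, ?_⟩, fun c hC => ?_, fun c hC => ?_⟩
  · exact ⟨hC.1.trans le_sup_right, hC.2.1, hC.2.2.1, fun c' _ hs hc hle =>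
      aux_i k g σ₁ σ₂ hcomm h1 h2 c hC c' hs hc hle⟩
  · exact ⟨hC.1.trans le_sup_right, hC.2.1, hC.2.2.1, fun c' _ hs hc hle =>
      aux_i k g σ₁ σ₂ hcomm h1 h2 c hC c' hs hc hle⟩
  · exact aux_ii k g σ₁ σ₂ hcomm h2 c hC
  · have := aux_ii k g σ₂ σ₁ hσ' h1 c (by rwa [inf_comm])
    rwa [sup_comm, inf_comm (eigSub k g σ₂ 1), inf_comm (eigSub k g σ₂ (-1))] at this
end

section
/- Let {σ₁, σ₂} be a dyad of involutions of g, i.e., σ₁ and σ₂ are distinct commuting involutions conjugate by an inner automorphism of g, with quaternionic decomposition g = g₀₀ ⊕ g₀₁ ⊕ g₁₀ ⊕ g₁₁. Then any Cartan subspace of g₁₁ is also a Cartan subspace of g₁₀ ⊕ g₁₁ (the (−1)-eigenspace of σ₁) and of g₀₁ ⊕ g₁₁ (the (−1)-eigenspace of σ₂). -/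
open LieAlgebra Module

variable (k : Type*) [Field k] [IsAlgClosed k] [CharZero k]
variable (g : Type*) [LieRing g] [LieAlgebra k g] [FiniteDimensional k g]
  [LieAlgebra.IsSemisimple k g]

section PolyPart

noncomputable def dyPt (d : ℕ) (v : Fin d → g) : Fin d × Fin (finrank k g) → k :=
  fun p => (finBasis k g).repr (v p.1) p.2

noncomputable def dyD (d : ℕ) (x : g) :
    Derivation k (MvPolynomial (Fin d × Fin (finrank k g)) k)
      (MvPolynomial (Fin d × Fin (finrank k g)) k) :=
  MvPolynomial.mkDerivation k fun p =>
    ∑ q, MvPolynomial.C ((finBasis k g).repr ⁅x, finBasis k g q⁆ p.2) * MvPolynomial.X (p.1, q)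

theorem dy_repr (f : g →ₗ[k] g) (v : g) (a : Fin (finrank k g)) :
    ∑ q, (finBasis k g).repr (f (finBasis k g q)) a * (finBasis k g).repr v q
      = (finBasis k g).repr (f v) a := by
  conv_rhs => rw [← (finBasis k g).sum_repr v]
  rw [map_sum, map_sum, Finsupp.coe_finset_sum, Finset.sum_apply]
  refine Finset.sum_congr rfl fun q _ => ?_
  rw [map_smul, map_smul, Finsupp.smul_apply, smul_eq_mul, mul_comm]

theorem dyPt_surj (d : ℕ) (p : Fin d × Fin (finrank k g) → k) :
    ∃ v, dyPt k g d v = p := by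
  refine ⟨fun i => ∑ q, p (i, q) • finBasis k g q, ?_⟩
  funext ⟨i, a⟩
  simp only [dyPt]
  rw [Basis.repr_sum_self]

theorem dyD_X (d : ℕ) (x : g) (p) :
    dyD k g d x (MvPolynomial.X p) = ∑ q, MvPolynomial.C ((finBasis k g).repr
      ⁅x, finBasis k g q⁆ p.2) * MvPolynomial.X (p.1, q) := by
  rw [dyD, MvPolynomial.mkDerivation_X]

theorem dyD_X_eval (d : ℕ) (x : g) (v : Fin d → g) (p) :
    MvPolynomial.eval (dyPt k g d v) (dyD k g d x (MvPolynomial.X p))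
      = (finBasis k g).repr ⁅x, v p.1⁆ p.2 := by
  rw [dyD_X]
  have := dy_repr k g (ad k g x) (v p.1) p.2
  simpa [dyPt] using this

theorem dy_funext (d : ℕ) {f h : MvPolynomial (Fin d × Fin (finrank k g)) k}
    (H : ∀ v, MvPolynomial.eval (dyPt k g d v) f = MvPolynomial.eval (dyPt k g d v) h) : f = h := by
  apply MvPolynomial.funext
  intro p
  obtain ⟨v, rfl⟩ := dyPt_surj k g d p
  exact H v

theorem dyD_add (d : ℕ) (x y : g) : dyD k g d (x + y) = dyD k g d x + dyD k g d y := by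
  apply MvPolynomial.derivation_ext
  intro p
  apply dy_funext
  intro v
  simp [dyD_X_eval]

theorem dyD_comm (d : ℕ) (x y : g) : ⁅dyD k g d x, dyD k g d y⁆ = dyD k g d ⁅y, x⁆ := by
  apply MvPolynomial.derivation_ext
  intro p
  apply dy_funext
  intro v
  have key : ∀ x y : g, MvPolynomial.eval (dyPt k g d v)
      (dyD k g d x (dyD k g d y (MvPolynomial.X p)))
      = (finBasis k g).repr ⁅y, ⁅x, v p.1⁆⁆ p.2 := by
    intro x y
    rw [dyD_X k g d y]
    have := dy_repr k g (ad k g y) ⁅x, v p.1⁆ p.2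
    rw [map_sum, map_sum]
    refine Eq.trans (Finset.sum_congr rfl fun q _ => ?_) this
    rw [Derivation.leibniz, MvPolynomial.derivation_C, smul_zero, add_zero, smul_eq_mul, map_mul,
      MvPolynomial.eval_C, dyD_X_eval]
    rfl
  rw [Derivation.commutator_apply, map_sub, key, key, dyD_X_eval, ← Finsupp.sub_apply, ← map_sub]
  congr 2
  rw [lie_lie]

/-- derivative along a curve -/
theorem dy_curve (d : ℕ) (x : g) (γ : Fin d × Fin (finrank k g) → Polynomial k) (t : k)
    (h : ∀ p, (Polynomial.derivative (γ p)).eval t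
      = (MvPolynomial.aeval γ (dyD k g d x (MvPolynomial.X p))).eval t)
    (f : MvPolynomial (Fin d × Fin (finrank k g)) k) :
    (Polynomial.derivative (MvPolynomial.aeval γ f)).eval t
      = (MvPolynomial.aeval γ (dyD k g d x f)).eval t := by
  induction f using MvPolynomial.induction_on with
  | C a => simp [MvPolynomial.algebraMap_eq]
  | add p q hp hq => simp [hp, hq]
  | mul_X p n hp =>
    simp only [map_mul, Polynomial.derivative_mul, Polynomial.eval_add, Polynomial.eval_mul, hp,
      Derivation.leibniz, smul_eq_mul, map_add, MvPolynomial.aeval_X, h]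
    ring

theorem dy_eval_aeval (d : ℕ) (γ : Fin d × Fin (finrank k g) → Polynomial k) (t : k)
    (f : MvPolynomial (Fin d × Fin (finrank k g)) k) :
    (MvPolynomial.aeval γ f).eval t = MvPolynomial.eval (fun p => (γ p).eval t) f := by
  induction f using MvPolynomial.induction_on with
  | C a => simp [MvPolynomial.algebraMap_eq]
  | add p q hp hq => simp [hp, hq]
  | mul_X p n hp => simp [hp]

theorem dy_normalizer (d : ℕ) (U : Submodule k g) (b : g) (hb : ∀ u ∈ U, ⁅b, u⁆ ∈ U)
    (f : MvPolynomial (Fin d × Fin (finrank k g)) k)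
    (hf : ∀ v : Fin d → g, (∀ i, v i ∈ U) → MvPolynomial.eval (dyPt k g d v) f = 0)
    (v : Fin d → g) (hv : ∀ i, v i ∈ U) :
    MvPolynomial.eval (dyPt k g d v) (dyD k g d b f) = 0 := by
  let γ : Fin d × Fin (finrank k g) → Polynomial k := fun p =>
    Polynomial.C (dyPt k g d v p) + Polynomial.X * Polynomial.C (dyPt k g d (fun i => ⁅b, v i⁆) p)
  have hγ : ∀ t : k, (fun p => (γ p).eval t) = dyPt k g d (fun i => v i + t • ⁅b, v i⁆) := by
    intro t; funext p; simp only [γ, dyPt]; simp; ring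
  have h0 : MvPolynomial.aeval γ f = 0 := by
    apply Polynomial.funext
    intro t
    rw [dy_eval_aeval, hγ, Polynomial.eval_zero]
    exact hf _ fun i => U.add_mem (hv i) (U.smul_mem _ (hb _ (hv i)))
  have := dy_curve k g d b γ 0 (by
    intro p
    rw [dy_eval_aeval, hγ]
    simp only [zero_smul, add_zero]
    rw [dyD_X_eval]
    simp [γ, dyPt]) f
  rw [h0, dy_eval_aeval, hγ] at this
  simpa using this.symm

theorem dy_pow_finrank {f : Module.End k g} (hf : IsNilpotent f) : f ^ (finrank k g + 1) = 0 := by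
  obtain ⟨n, hn⟩ := hf
  have h1 : f ^ (finrank k g) = 0 := by
    rw [← LinearMap.ker_eq_top]
    rcases le_total (finrank k g) n with h | h
    · rw [← Module.End.ker_pow_eq_ker_pow_finrank_of_le h, hn, LinearMap.ker_zero]
    · rw [LinearMap.ker_eq_top]
      exact pow_eq_zero_of_le h hn
  rw [pow_succ, h1, zero_mul]

theorem dy_exp (d : ℕ) (J : Submodule k (MvPolynomial (Fin d × Fin (finrank k g)) k))
    (hJ : ∀ x, ∀ f ∈ J, dyD k g d x f ∈ J) (v : Fin d → g)
    (hv : ∀ f ∈ J, MvPolynomial.eval (dyPt k g d v) f = 0) (x : g) (hx : IsNilpotent (ad k g x))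
    (f) (hf : f ∈ J) :
    MvPolynomial.eval (dyPt k g d fun i => expEnd k g (ad k g x) (v i)) f = 0 := by
  let N := finrank k g
  let γ : Fin d × Fin (finrank k g) → Polynomial k := fun p =>
    ∑ n ∈ Finset.range (N + 1), Polynomial.C ((n.factorial : k)⁻¹ *
      (finBasis k g).repr (((ad k g x) ^ n) (v p.1)) p.2) * Polynomial.X ^ n
  have hγ : ∀ t : k, (fun p => (γ p).eval t) = dyPt k g d
      (fun i => ∑ n ∈ Finset.range (N + 1), ((n.factorial : k)⁻¹ * t ^ n) •
        (((ad k g x) ^ n) (v i))) := by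
    intro t; funext p
    simp only [γ, dyPt, Polynomial.eval_finset_sum, map_sum, map_smul, Finsupp.coe_finset_sum,
      Finset.sum_apply, Polynomial.eval_mul, Polynomial.eval_C, Polynomial.eval_pow,
      Polynomial.eval_X, Finsupp.smul_apply, smul_eq_mul]
    exact Finset.sum_congr rfl fun n _ => by ring
  have hder : ∀ f, Polynomial.derivative (MvPolynomial.aeval γ f)
      = MvPolynomial.aeval γ (dyD k g d x f) := by
    intro f
    apply Polynomial.funext
    intro t
    apply dy_curve
    intro p
    rw [dy_eval_aeval, hγ, dyD_X_eval]
    simp only [γ, Polynomial.derivative_sum, Polynomial.eval_finset_sum, lie_sum, map_sum,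
      Finsupp.coe_finset_sum, Finset.sum_apply]
    rw [Finset.sum_range_succ', Finset.sum_range_succ]
    have h1 : ⁅x, ((ad k g x) ^ N) (v p.1)⁆ = 0 := by
      have := dy_pow_finrank k g hx
      rw [pow_succ'] at this
      have := LinearMap.congr_fun this (v p.1)
      simpa using this
    rw [lie_smul, h1]
    simp only [smul_zero, map_zero, Finsupp.coe_zero, Pi.zero_apply, add_zero]
    have h2 : Polynomial.eval t (Polynomial.derivative (Polynomial.C (((0:ℕ).factorial : k)⁻¹ *
      (finBasis k g).repr (((ad k g x) ^ 0) (v p.1)) p.2) * Polynomial.X ^ 0)) = 0 := by simp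
    rw [h2, add_zero]
    refine Finset.sum_congr rfl fun n _ => ?_
    have h3 : ((n.factorial : k)) ≠ 0 := by exact_mod_cast n.factorial_ne_zero
    have h4 : ((n : k) + 1) ≠ 0 := by exact_mod_cast n.succ_ne_zero
    rw [pow_succ' (ad k g x)]
    simp only [Nat.factorial_succ, lie_smul, map_smul, Finsupp.smul_apply, smul_eq_mul,
      Polynomial.derivative_C_mul, Polynomial.derivative_X_pow, Polynomial.eval_mul,
      Polynomial.eval_C, Polynomial.eval_pow, Polynomial.eval_X, Module.End.mul_apply, ad_apply]
    push_cast
    field_simp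
  have hit : ∀ n : ℕ, ∀ f ∈ J, (Polynomial.derivative^[n] (MvPolynomial.aeval γ f)).eval 0 = 0 := by
    intro n
    induction n with
    | zero =>
      intro f hf
      rw [Function.iterate_zero, id, dy_eval_aeval, hγ]
      convert hv f hf using 4 with i
      funext i
      rw [Finset.sum_range_succ']
      simp
    | succ n ih =>
      intro f hf
      rw [Function.iterate_succ, Function.comp, hder]
      exact ih _ (hJ _ _ hf)
  have hz : MvPolynomial.aeval γ f = 0 := by
    ext n
    have := hit n f hf
    rw [← Polynomial.coeff_zero_eq_eval_zero, Polynomial.coeff_iterate_derivative] at this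
    rw [zero_add, Nat.descFactorial_self, nsmul_eq_mul] at this
    simpa [n.factorial_ne_zero] using this
  have := congrArg (Polynomial.eval 1) hz
  rw [dy_eval_aeval, hγ] at this
  simp only [expEnd]
  simpa [LinearMap.sum_apply] using this

theorem expEnd_mul_neg {f : Module.End k g} (hf : IsNilpotent f) :
    expEnd k g (-f) * expEnd k g f = 1 := by
  letI : Algebra ℚ k := DivisionRing.toRatAlgebra
  letI : Algebra ℚ (Module.End k g) := Algebra.compHom _ (algebraMap ℚ k)
  haveI : IsScalarTower ℚ k (Module.End k g) := IsScalarTower.of_algebraMap_smul fun r x => rfl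
  have h : ∀ f : Module.End k g, IsNilpotent f → expEnd k g f = IsNilpotent.exp f := by
    intro f hf
    rw [IsNilpotent.exp_eq_sum (dy_pow_finrank k g hf), expEnd]
    refine Finset.sum_congr rfl fun i _ => ?_
    rw [← algebraMap_smul k ((i.factorial : ℚ)⁻¹)]
    simp
  rw [h f hf, h _ hf.neg, IsNilpotent.exp_neg_mul_exp_self hf]

theorem dy_words {A : Type*} [AddCommGroup A] [Module k A] (D : g → A →ₗ[k] A)
    (hadd : ∀ x y f, D (x + y) f = D x f + D y f)
    (hD : ∀ x y f, D x (D y f) - D y (D x f) = D ⁅y, x⁆ f)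
    (K : Set g) (I : Submodule k A) (f0 : A) (hf0 : f0 ∈ I) (hK : ∀ a ∈ K, D a f0 = 0)
    (hdec : ∀ x, ∃ a ∈ K, ∃ b, x = a + b ∧ ∀ f ∈ I, D b f ∈ I) :
    ∃ J : Submodule k A, f0 ∈ J ∧ J ≤ I ∧ ∀ x, ∀ f ∈ J, D x f ∈ J := by
  let Fil : ℕ → Submodule k A := fun n => Nat.rec (Submodule.span k {f0})
    (fun _ F => F ⊔ Submodule.span k {h | ∃ x, ∃ f ∈ F, h = D x f}) n
  have hs : ∀ n, Fil (n + 1) = Fil n ⊔ Submodule.span k {h | ∃ x, ∃ f ∈ Fil n, h = D x f} :=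
    fun n => rfl
  have hmono : Monotone Fil := monotone_nat_of_le_succ fun n => by rw [hs]; exact le_sup_left
  have hstep : ∀ n x, ∀ f ∈ Fil n, D x f ∈ Fil (n + 1) := by
    intro n x f hf
    rw [hs]
    exact le_sup_right (a := Fil n) (Submodule.subset_span ⟨x, f, hf, rfl⟩)
  have hKF : ∀ n, ∀ a ∈ K, ∀ f ∈ Fil n, D a f ∈ Fil n := by
    intro n
    induction n with
    | zero =>
      intro a ha f hf
      obtain ⟨c, rfl⟩ := Submodule.mem_span_singleton.1 hf
      rw [map_smul, hK a ha, smul_zero]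
      exact Submodule.zero_mem _
    | succ n ih =>
      intro a ha
      suffices Fil (n + 1) ≤ (Fil (n + 1)).comap (D a) from fun f hf => this hf
      conv_lhs => rw [hs]
      refine sup_le (fun f hf => hstep n a f hf) (Submodule.span_le.2 ?_)
      rintro _ ⟨x, f, hf, rfl⟩
      have : D a (D x f) = D x (D a f) + D ⁅x, a⁆ f := by rw [← hD]; abel
      change D a (D x f) ∈ Fil (n + 1)
      rw [this]
      exact Submodule.add_mem _ (hstep n x _ (ih a ha f hf)) (hstep n _ f hf)
  have hI : ∀ n, Fil n ≤ I := by
    intro n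
    induction n with
    | zero => exact (Submodule.span_singleton_le_iff_mem _ _).2 hf0
    | succ n ih =>
      rw [hs]
      refine sup_le ih (Submodule.span_le.2 ?_)
      rintro _ ⟨x, f, hf, rfl⟩
      obtain ⟨a, ha, b, rfl, hb⟩ := hdec x
      rw [hadd]
      exact I.add_mem (ih (hKF n a ha f hf)) (hb f (ih hf))
  refine ⟨⨆ n, Fil n, ?_, iSup_le hI, ?_⟩
  · exact Submodule.mem_iSup_of_mem 0 (Submodule.mem_span_singleton_self _)
  · intro x f hf
    obtain ⟨n, hn⟩ := (Submodule.mem_iSup_of_directed _ hmono.directed_le).1 hf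
    exact Submodule.mem_iSup_of_mem (n + 1) (hstep n x f hn)

theorem dy_det_zero {R S : Type*} [CommRing R] [CommRing S] [Algebra R S] (D : Derivation R S S)
    {n : ℕ} (M : Matrix (Fin n) (Fin n) S) (h : ∀ i j, D (M i j) = 0) : D M.det = 0 := by
  have hp : ∀ (s : Finset (Fin n)) (F : Fin n → S), (∀ i, D (F i) = 0) → D (∏ i ∈ s, F i) = 0 := by
    intro s F hF
    induction s using Finset.induction_on with
    | empty => simp
    | insert a s ha ih => rw [Finset.prod_insert ha, D.leibniz, ih, hF]; simp
  rw [Matrix.det_apply, map_sum]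
  refine Finset.sum_eq_zero fun σ _ => ?_
  rw [Units.smul_def, map_zsmul, hp _ _ fun i => h _ _, smul_zero]

theorem dy_transport (β : g →ₗ[k] g →ₗ[k] k) (K : Set g)
    (hK : ∀ a ∈ K, ∀ x y, β ⁅a, x⁆ y + β x ⁅a, y⁆ = 0) (U : Submodule k g)
    (hdec : ∀ x, ∃ a ∈ K, ∃ b, x = a + b ∧ ∀ u ∈ U, ⁅b, u⁆ ∈ U)
    (u0 : g) (hu0 : u0 ∈ U) (hne : u0 ≠ 0) (hdeg : ∀ u ∈ U, β u0 u = 0)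
    (φ : g ≃ₗ[k] g) (hφ : φ ∈ Subgroup.closure
    {e : g ≃ₗ[k] g | ∃ x : g, IsNilpotent (ad k g x) ∧
      (e : g →ₗ[k] g) = expEnd k g (ad k g x)}) :
    ∃ u ∈ U, u ≠ 0 ∧ ∀ u' ∈ U, β (φ u) (φ u') = 0 := by
  let d := finrank k U
  let bs := finBasis k g
  let M : Matrix (Fin d) (Fin d) (MvPolynomial (Fin d × Fin (finrank k g)) k) := fun i j =>
    ∑ a, ∑ a', MvPolynomial.C (β (bs a) (bs a')) * (MvPolynomial.X (i, a) * MvPolynomial.X (j, a'))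
  have hβ : ∀ x y, ∑ a, ∑ a', β (bs a) (bs a') * (bs.repr x a * bs.repr y a') = β x y := by
    intro x y
    conv_rhs => rw [← bs.sum_repr x, ← bs.sum_repr y]
    simp only [map_sum, map_smul, LinearMap.sum_apply, LinearMap.smul_apply, smul_eq_mul,
      Finset.mul_sum]
    rw [Finset.sum_comm]
    exact Finset.sum_congr rfl fun a _ => Finset.sum_congr rfl fun a' _ => by ring
  have hM : ∀ v i j, MvPolynomial.eval (dyPt k g d v) (M i j) = β (v i) (v j) := by
    intro v i j
    rw [← hβ]
    simp [M, dyPt, bs]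
  have hMdet : ∀ v, MvPolynomial.eval (dyPt k g d v) M.det
      = Matrix.det (fun i j => β (v i) (v j) : Matrix (Fin d) (Fin d) k) := by
    intro v
    rw [RingHom.map_det]
    congr 1
    ext i j
    simp [hM]
  let I : Submodule k (MvPolynomial (Fin d × Fin (finrank k g)) k) :=
    { carrier := {f | ∀ v : Fin d → g, (∀ i, v i ∈ U) → MvPolynomial.eval (dyPt k g d v) f = 0}
      add_mem' := by
        intro a b ha hb v hv
        rw [map_add, ha v hv, hb v hv, add_zero]
      zero_mem' := by intro v hv; simp
      smul_mem' := by
        intro c a ha v hv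
        rw [MvPolynomial.smul_eval, ha v hv, mul_zero] }
  have hdet0 : M.det ∈ I := by
    intro v hv
    rw [hMdet]
    apply Matrix.exists_vecMul_eq_zero_iff.1
    by_cases hli : LinearIndependent k v
    · have hv' : LinearIndependent k (fun i => (⟨v i, hv i⟩ : U)) :=
        LinearIndependent.of_comp U.subtype hli
      have hsp := hv'.span_eq_top_of_card_eq_finrank' (by simp [d])
      have : (⟨u0, hu0⟩ : U) ∈ Submodule.span k (Set.range fun i => (⟨v i, hv i⟩ : U)) := by
        rw [hsp]; trivial
      obtain ⟨w, hw⟩ := (Submodule.mem_span_range_iff_exists_fun k).1 this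
      have hw' : ∑ i, w i • v i = u0 := by
        have := congrArg Subtype.val hw
        simpa using this
      refine ⟨w, ?_, ?_⟩
      · rintro rfl
        apply hne
        rw [← hw']; simp
      · funext j
        have := hdeg (v j) (hv j)
        rw [← hw'] at this
        simpa [Matrix.vecMul, dotProduct] using this
    · rw [Fintype.not_linearIndependent_iff] at hli
      obtain ⟨w, hw, i, hi⟩ := hli
      refine ⟨w, fun h => hi (by rw [h]; rfl), ?_⟩
      funext j
      have := congrArg (fun z => β z (v j)) hw
      simpa [Matrix.vecMul, dotProduct] using this
  have hK0 : ∀ a ∈ K, dyD k g d a M.det = 0 := by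
    intro a ha
    apply dy_det_zero
    intro i j
    apply dy_funext
    intro v
    rw [map_zero, ← hK a ha (v i) (v j), ← hβ, ← hβ (v i)]
    simp only [M, map_sum, Derivation.leibniz, MvPolynomial.derivation_C, smul_zero, add_zero,
      smul_eq_mul, map_mul, MvPolynomial.eval_C, map_add, dyD_X_eval, MvPolynomial.eval_X, dyPt,
      map_zero, mul_zero, ← Finset.sum_add_distrib, bs]
    exact Finset.sum_congr rfl fun a _ => Finset.sum_congr rfl fun a' _ => by ring
  obtain ⟨J, hJ0, hJI, hJD⟩ := dy_words k g (fun x => (dyD k g d x).toLinearMap)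
    (fun x y f => by simp [dyD_add]) (fun x y f => by
      have := DFunLike.congr_fun (dyD_comm k g d x y) f
      rw [Derivation.commutator_apply] at this
      simpa using this) K I M.det hdet0 (fun a ha => by simpa using hK0 a ha)
    (fun x => by
      obtain ⟨a, ha, b, hx, hb⟩ := hdec x
      refine ⟨a, ha, b, hx, fun f hf v hv => ?_⟩
      exact dy_normalizer k g d U b hb f hf v hv)
  have hstab : ∀ v : Fin d → g, (∀ f ∈ J, MvPolynomial.eval (dyPt k g d v) f = 0) →
      ∀ f ∈ J, MvPolynomial.eval (dyPt k g d (fun i => φ (v i))) f = 0 := by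
    induction hφ using Subgroup.closure_induction'' with
    | mem e he =>
      obtain ⟨x, hx, he⟩ := he
      intro v hv f hf
      have : ∀ z, e z = expEnd k g (ad k g x) z := fun z => by rw [← he]; rfl
      simp only [this]
      exact dy_exp k g d J (fun x f hf => hJD x f hf) v hv x hx f hf
    | inv_mem e he =>
      obtain ⟨x, hx, he⟩ := he
      intro v hv f hf
      have hx' : IsNilpotent (ad k g (-x)) := by rw [map_neg]; exact hx.neg
      have : ∀ z, e⁻¹ z = expEnd k g (ad k g (-x)) z := fun z => by
        have h1 := LinearMap.congr_fun (expEnd_mul_neg k g hx) (e⁻¹ z)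
        rw [Module.End.mul_apply, ← he] at h1
        rw [map_neg]
        have h2 : (e : g →ₗ[k] g) (e⁻¹ z) = z := e.apply_symm_apply z
        rw [h2] at h1
        exact h1.symm
      simp only [this]
      exact dy_exp k g d J (fun x f hf => hJD x f hf) v hv (-x) hx' f hf
    | one => intro v hv f hf; exact hv f hf
    | mul e e' _ _ h1 h2 =>
      intro v hv f hf
      exact h1 _ (h2 v hv) f hf
  let E := finBasis k U
  have hfin := hstab (fun i => (E i : g)) (fun f hf => hJI hf _ fun i => (E i).2) M.det hJ0
  rw [hMdet] at hfin
  obtain ⟨w, hw0, hw⟩ := Matrix.exists_vecMul_eq_zero_iff.2 hfin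
  refine ⟨∑ i, w i • (E i : g), U.sum_mem fun i _ => U.smul_mem _ (E i).2, ?_, ?_⟩
  · intro h
    apply hw0
    have h' : ∑ i, w i • E i = 0 := by
      apply Subtype.ext
      simpa using h
    funext i
    exact Fintype.linearIndependent_iff.1 E.linearIndependent w h' i
  · intro u' hu'
    have h1 : ∀ j, β (φ (∑ i, w i • (E i : g))) (φ (E j)) = 0 := by
      intro j
      have := congrFun hw j
      simpa [Matrix.vecMul, dotProduct] using this
    have h2 : u' = ∑ j, E.repr ⟨u', hu'⟩ j • (E j : g) := by
      have := congrArg Subtype.val (E.sum_repr ⟨u', hu'⟩)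
      rw [Submodule.coe_sum] at this
      exact this.symm
    rw [h2, map_sum φ (fun j => E.repr ⟨u', hu'⟩ j • (E j : g)), map_sum]
    refine Finset.sum_eq_zero fun j _ => ?_
    rw [map_smul, map_smul, h1, smul_zero]

end PolyPart

section OrderPart

theorem dy_order (A : Type*) [AddCommGroup A] [Module ℚ A] :
    ∃ P : A → Prop, (∀ a b, P a → P b → P (a + b)) ∧ ¬ P 0 ∧ ∀ a, a = 0 ∨ P a ∨ P (-a) := by
  classical
  let b := Basis.ofVectorSpace ℚ A
  letI : LinearOrder (Basis.ofVectorSpaceIndex ℚ A) := linearOrderOfSTO WellOrderingRel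
  let ψ : A → Lex (Basis.ofVectorSpaceIndex ℚ A →₀ ℚ) := fun a => toLex (b.repr a)
  have hadd : ∀ x y, ψ (x + y) = ψ x + ψ y := fun x y => by simp [ψ]
  have hneg : ∀ x, ψ (-x) = - ψ x := fun x => by simp [ψ]
  have h0 : ψ 0 = 0 := by simp [ψ]
  have hinj : ∀ x, ψ x = 0 → x = 0 := fun x hx => by
    have : b.repr x = 0 := hx
    simpa using this
  refine ⟨fun a => 0 < ψ a, ?_, ?_, ?_⟩
  · intro x y hx hy
    change 0 < ψ (x + y)
    rw [hadd]; exact add_pos hx hy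
  · change ¬ (0 < ψ 0)
    rw [h0]; exact lt_irrefl _
  · intro a
    rcases lt_trichotomy (ψ a) 0 with h | h | h
    · right; right; change 0 < ψ (-a); rw [hneg]; exact neg_pos.2 h
    · left; exact hinj a h
    · right; left; exact h

end OrderPart

section LiePart

theorem dy_kill_zero (x : g) (h : ∀ y, killingForm k g x y = 0) : x = 0 :=
  (IsKilling.killingForm_nondegenerate k g).1 x h

theorem dy_kill_comm (x y : g) : killingForm k g x y = killingForm k g y x :=
  LieModule.traceForm_comm k g g x y

theorem dy_kill_inv (x y z : g) : killingForm k g ⁅x, y⁆ z = killingForm k g x ⁅y, z⁆ :=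
  LieModule.traceForm_apply_lie_apply k g g x y z

theorem dy_ad_zero (x : g) (h : ad k g x = 0) : x = 0 := by
  apply dy_kill_zero k g
  intro y
  rw [killingForm_apply_apply, h, LinearMap.zero_comp, map_zero]

theorem dy_commute (x y : g) : Commute (ad k g x) (ad k g y) ↔ ⁅x, y⁆ = 0 := by
  constructor
  · intro h
    apply dy_ad_zero k g
    ext z
    have := LinearMap.congr_fun h.eq z
    simp only [Module.End.mul_apply, ad_apply] at this
    rw [ad_apply, lie_lie, this, sub_self, LinearMap.zero_apply]
  · intro h
    ext z
    simp only [Module.End.mul_apply, ad_apply]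
    rw [leibniz_lie x y z, h, zero_lie, zero_add]

theorem dy_kill_nilp (z n : g) (h : ⁅z, n⁆ = 0) (hn : IsNilpotent (ad k g n)) :
    killingForm k g z n = 0 := by
  rw [killingForm_apply_apply]
  have h1 : Commute (ad k g z) (ad k g n) := (dy_commute k g z n).2 h
  exact (LinearMap.isNilpotent_trace_of_isNilpotent (h1.isNilpotent_mul_left hn)).eq_zero

theorem dy_ad_conj (σ : g ≃ₗ⁅k⁆ g) (x : g) :
    ad k g (σ x) = LinearEquiv.conjAlgEquiv k σ.toLinearEquiv (ad k g x) := by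
  ext y
  change ⁅σ x, y⁆ = σ ⁅x, σ.symm y⁆
  rw [LieEquiv.map_lie, LieEquiv.apply_symm_apply]

theorem dy_ss_conj (σ : g ≃ₗ⁅k⁆ g) (x : g) (h : IsSSElt k g x) : IsSSElt k g (σ x) := by
  unfold IsSSElt at *
  rw [dy_ad_conj]
  refine Module.End.isSemisimple_of_squarefree_aeval_eq_zero h.minpoly_squarefree ?_
  rw [← minpoly.algEquiv_eq (LinearEquiv.conjAlgEquiv k σ.toLinearEquiv)]
  exact minpoly.aeval _ _

theorem dy_nilp_conj (σ : g ≃ₗ⁅k⁆ g) (x : g) (h : IsNilpotent (ad k g x)) :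
    IsNilpotent (ad k g (σ x)) := by
  rw [dy_ad_conj]
  exact h.map _

theorem dy_ss_smul (t : k) (x : g) (h : IsSSElt k g x) : IsSSElt k g (t • x) := by
  unfold IsSSElt at *
  rw [map_smul]
  have : t • ad k g x = Polynomial.aeval (ad k g x) (Polynomial.C t * Polynomial.X) := by
    simp [Algebra.smul_def]
  rw [this]
  exact h.aeval _

theorem dy_ss_neg (x : g) (h : IsSSElt k g x) : IsSSElt k g (-x) := by
  have := dy_ss_smul k g (-1) x h
  simpa using this

theorem dy_ss_add (x y : g) (hx : IsSSElt k g x) (hy : IsSSElt k g y) (h : ⁅x, y⁆ = 0) :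
    IsSSElt k g (x + y) := by
  unfold IsSSElt at *
  rw [map_add]
  exact Module.End.IsSemisimple.add_of_commute ((dy_commute k g x y).2 h) hx hy

theorem dy_jordan (x : g) : ∃ s n : g, x = s + n ∧ IsSSElt k g s ∧ IsNilpotent (ad k g n) ∧
    ⁅s, n⁆ = 0 ∧ ∀ z : g, ⁅x, z⁆ = 0 → ⁅s, z⁆ = 0 := by
  obtain ⟨N, -, S, hS₀, hN, hS, hSN⟩ := (ad k g x).exists_isNilpotent_isSemisimple
  have hS₁ : Commute (ad k g x) S := Algebra.commute_of_mem_adjoin_self hS₀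
  have hN' : IsNilpotent (ad k g x - S) := by rw [hSN, add_sub_cancel_right]; exact hN
  have aux {μ : k} {y : g} (hy : y ∈ (ad k g x).maxGenEigenspace μ) : S y = μ • y := by
    rw [Module.End.maxGenEigenspace_eq] at hy
    exact Module.End.apply_eq_of_mem_of_comm_of_isFinitelySemisimple_of_isNil hy hS₁
      hS.isFinitelySemisimple hN'
  have h_der (y z : g) : S ⁅y, z⁆ = ⁅S y, z⁆ + ⁅y, S z⁆ := by
    have hy : y ∈ ⨆ μ : k, (ad k g x).maxGenEigenspace μ := by
      rw [Module.End.iSup_maxGenEigenspace_eq_top]; trivial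
    have hz : z ∈ ⨆ μ : k, (ad k g x).maxGenEigenspace μ := by
      rw [Module.End.iSup_maxGenEigenspace_eq_top]; trivial
    induction hy using Submodule.iSup_induction' with
    | mem α y hy =>
      induction hz using Submodule.iSup_induction' with
      | mem β z hz =>
        have hyz : ⁅y, z⁆ ∈ (ad k g x).maxGenEigenspace (α + β) :=
          LieModule.lie_mem_maxGenEigenspace_toEnd hy hz
        rw [aux hy, aux hz, aux hyz, smul_lie, lie_smul, ← add_smul]
      | zero => simp
      | add _ _ _ _ h h' => simp only [lie_add, map_add, h, h']; abel
    | zero => simp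
    | add _ _ _ _ h h' => simp only [add_lie, map_add, h, h']; abel
  replace h_der : ∀ y z : g, S ⁅y, z⁆ = ⁅y, S z⁆ - ⁅z, S y⁆ := by
    simp_rw [← lie_skew (S _) _, add_comm, ← sub_eq_add_neg] at h_der; assumption
  let S' : LieDerivation k g g := ⟨S, h_der⟩
  obtain ⟨s, hs⟩ := LieDerivation.IsKilling.exists_eq_ad S'
  replace hs : ad k g s = S := by rw [← LieDerivation.coe_ad_apply_eq_ad_apply s, hs]
  have hz : ∀ z : g, ⁅x, z⁆ = 0 → ⁅s, z⁆ = 0 := by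
    intro z hz
    rw [← dy_commute k g, hs]
    have h1 : Commute (ad k g z) (ad k g x) := ((dy_commute k g x z).2 hz).symm
    exact (Algebra.commute_of_mem_adjoin_singleton_of_commute hS₀ h1).symm
  refine ⟨s, x - s, by abel, ?_, ?_, ?_, hz⟩
  · unfold IsSSElt; rw [hs]; exact hS
  · rw [map_sub, hs]; exact hN'
  · rw [lie_sub, lie_self, sub_zero]; exact hz x (lie_self x)

theorem dy_unique (s n s' n' : g) (h : s + n = s' + n') (hs : IsSSElt k g s)
    (hs' : IsSSElt k g s') (hn : IsNilpotent (ad k g n)) (hn' : IsNilpotent (ad k g n'))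
    (hc : ⁅s, n⁆ = 0) (hc' : ⁅s', n'⁆ = 0) : s = s' := by
  have h1 := Module.End.isNilpotent_isSemisimple_unique hn hs hn' hs'
    ((dy_commute k g s n).2 hc).symm ((dy_commute k g s' n').2 hc').symm
    (by rw [← map_add, ← map_add, add_comm n, h, add_comm])
  have h2 : ad k g (s - s') = 0 := by rw [map_sub, h1.2, sub_self]
  exact sub_eq_zero.1 (dy_ad_zero k g _ h2)

theorem dy_jordan_neg (σ : g ≃ₗ⁅k⁆ g) (s n : g) (hs : IsSSElt k g s)
    (hn : IsNilpotent (ad k g n)) (hc : ⁅s, n⁆ = 0) (h : σ (s + n) = -(s + n)) : σ s = -s := by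
  refine dy_unique k g (σ s) (σ n) (-s) (-n) ?_ (dy_ss_conj k g σ s hs) (dy_ss_neg k g s hs)
    (dy_nilp_conj k g σ n hn) ?_ ?_ ?_
  · rw [← map_add, h, neg_add]
  · rw [map_neg]; exact hn.neg
  · rw [← LieEquiv.map_lie, hc, map_zero]
  · rw [lie_neg, neg_lie, hc]; simp

/-- joint eigenspace -/
def dyWt {ι : Type*} (h : ι → g) (χ : ι → k) : Submodule k g where
  carrier := {x | ∀ i, ⁅h i, x⁆ = χ i • x}
  add_mem' := by
    intro a b ha hb i
    rw [lie_add, ha i, hb i, smul_add]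
  zero_mem' := by intro i; simp
  smul_mem' := by
    intro t a ha i
    rw [lie_smul, ha i, smul_comm]

theorem dyWt_mem {ι : Type*} (h : ι → g) (χ : ι → k) (x : g) :
    x ∈ dyWt k g h χ ↔ ∀ i, ⁅h i, x⁆ = χ i • x := Iff.rfl

theorem dyWt_top {ι : Type*} (h : ι → g) (hs : ∀ i, IsSSElt k g (h i))
    (hc : ∀ i j, ⁅h i, h j⁆ = 0) : ⨆ χ, dyWt k g h χ = ⊤ := by
  have := Module.End.iSup_iInf_maxGenEigenspace_eq_top_of_iSup_maxGenEigenspace_eq_top_of_commute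
    (fun i => ad k g (h i)) (fun i j _ => (dy_commute k g _ _).2 (hc i j))
    (fun i => Module.End.iSup_maxGenEigenspace_eq_top _)
  rw [← this]
  congr 1
  funext χ
  ext x
  rw [dyWt_mem, Submodule.mem_iInf]
  refine forall_congr' fun i => ?_
  rw [(hs i).isFinitelySemisimple.maxGenEigenspace_eq_eigenspace, Module.End.mem_eigenspace_iff]
  rfl

theorem dyWt_lie {ι : Type*} (h : ι → g) (χ χ' : ι → k) (x y : g) (hx : x ∈ dyWt k g h χ)
    (hy : y ∈ dyWt k g h χ') : ⁅x, y⁆ ∈ dyWt k g h (χ + χ') := by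
  intro i
  rw [leibniz_lie, hx i, hy i, smul_lie, lie_smul, ← add_smul]; rfl

theorem dyWt_kill {ι : Type*} (h : ι → g) (χ χ' : ι → k) (x y : g) (hx : x ∈ dyWt k g h χ)
    (hy : y ∈ dyWt k g h χ') (hne : χ + χ' ≠ 0) : killingForm k g x y = 0 := by
  obtain ⟨i, hi⟩ := Function.ne_iff.1 hne
  have h1 := dy_kill_inv k g x (h i) y
  rw [← lie_skew, hx i, hy i] at h1
  simp only [map_neg, map_smul, LinearMap.neg_apply, LinearMap.smul_apply, smul_eq_mul] at h1
  have h2 : (χ i + χ' i) * killingForm k g x y = 0 := by linear_combination -h1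
  exact (mul_eq_zero.1 h2).resolve_left hi

theorem dyWt_conj {ι : Type*} (h : ι → g) (χ χ' : ι → k) (σ : g ≃ₗ⁅k⁆ g) (hσ : ∀ x, σ (σ x) = x)
    (ε : ι → k) (hε : ∀ i, σ (h i) = ε i • h i) (hχ : ∀ i, χ' i = ε i * χ i) (x : g)
    (hx : x ∈ dyWt k g h χ) : σ x ∈ dyWt k g h χ' := by
  intro i
  have h1 : ⁅h i, σ x⁆ = σ ⁅σ (h i), x⁆ := by rw [LieEquiv.map_lie, hσ]
  rw [h1, hε, smul_lie, hx i, map_smul, map_smul, smul_smul, hχ]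

theorem dy_order_neg {A : Type*} [AddCommGroup A] (P : A → Prop)
    (h1 : ∀ a b, P a → P b → P (a + b)) (h0 : ¬ P 0) (a : A) (ha : P a) : ¬ P (-a) := by
  intro h
  apply h0
  have := h1 _ _ ha h
  rwa [add_neg_cancel] at this

end LiePart

section CentPart

structure DySetup (σ₁ σ₂ : g ≃ₗ⁅k⁆ g) (c : Submodule k g) : Prop where
  i1 : ∀ x, σ₁ (σ₁ x) = x
  i2 : ∀ x, σ₂ (σ₂ x) = x
  i12 : ∀ x, σ₁ (σ₂ x) = σ₂ (σ₁ x)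
  c1 : ∀ x ∈ c, σ₁ x = -x
  c2 : ∀ x ∈ c, σ₂ x = -x
  ss : ∀ x ∈ c, IsSSElt k g x
  cc : ∀ x ∈ c, ∀ y ∈ c, ⁅x, y⁆ = 0
  mx : ∀ s, σ₁ s = -s → σ₂ s = -s → IsSSElt k g s → (∀ z ∈ c, ⁅z, s⁆ = 0) → s ∈ c

structure DyL (σ₁ σ₂ : g ≃ₗ⁅k⁆ g) (c : Submodule k g) (x : g) : Prop where
  a1 : σ₁ x = -x
  a2 : σ₂ x = -x
  ac : ∀ z ∈ c, ⁅z, x⁆ = 0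

variable {σ₁ σ₂ : g ≃ₗ⁅k⁆ g} {c : Submodule k g}

theorem dyL_add {x y : g} (hx : DyL k g σ₁ σ₂ c x) (hy : DyL k g σ₁ σ₂ c y) :
    DyL k g σ₁ σ₂ c (x + y) := by
  refine ⟨?_, ?_, fun z hz => ?_⟩
  · rw [map_add, hx.a1, hy.a1]; abel
  · rw [map_add, hx.a2, hy.a2]; abel
  · rw [lie_add, hx.ac z hz, hy.ac z hz, add_zero]

theorem dyL_sub {x y : g} (hx : DyL k g σ₁ σ₂ c x) (hy : DyL k g σ₁ σ₂ c y) :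
    DyL k g σ₁ σ₂ c (x - y) := by
  refine ⟨?_, ?_, fun z hz => ?_⟩
  · rw [map_sub, hx.a1, hy.a1]; abel
  · rw [map_sub, hx.a2, hy.a2]; abel
  · rw [lie_sub, hx.ac z hz, hy.ac z hz, sub_zero]

theorem dyL_of_mem (S : DySetup k g σ₁ σ₂ c) {x : g} (hx : x ∈ c) : DyL k g σ₁ σ₂ c x :=
  ⟨S.c1 x hx, S.c2 x hx, fun z hz => S.cc z hz x hx⟩

theorem dyC1 (S : DySetup k g σ₁ σ₂ c) {y : g} (hy : ∀ z ∈ c, ⁅z, y⁆ = 0) :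
    ∀ z ∈ c, ⁅z, σ₁ y⁆ = 0 := by
  intro z hz
  have h1 : ⁅z, σ₁ y⁆ = σ₁ ⁅σ₁ z, y⁆ := by rw [LieEquiv.map_lie, S.i1]
  rw [h1, S.c1 z hz, neg_lie, hy z hz, neg_zero, map_zero]

theorem dyC2 (S : DySetup k g σ₁ σ₂ c) {y : g} (hy : ∀ z ∈ c, ⁅z, y⁆ = 0) :
    ∀ z ∈ c, ⁅z, σ₂ y⁆ = 0 := by
  intro z hz
  have h1 : ⁅z, σ₂ y⁆ = σ₂ ⁅σ₂ z, y⁆ := by rw [LieEquiv.map_lie, S.i2]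
  rw [h1, S.c2 z hz, neg_lie, hy z hz, neg_zero, map_zero]

theorem dy_A (S : DySetup k g σ₁ σ₂ c) {x : g} (hx : DyL k g σ₁ σ₂ c x) :
    ∃ s ∈ c, ∃ n, x = s + n ∧ IsNilpotent (ad k g n) ∧ DyL k g σ₁ σ₂ c n := by
  obtain ⟨s, n, rfl, hs, hn, hsn, hz⟩ := dy_jordan k g x
  have hsc : s ∈ c := by
    apply S.mx s (dy_jordan_neg k g σ₁ s n hs hn hsn hx.a1)
      (dy_jordan_neg k g σ₂ s n hs hn hsn hx.a2) hs
    intro z hzc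
    have h1 : ⁅s + n, z⁆ = 0 := by rw [← lie_skew, hx.ac z hzc, neg_zero]
    rw [← lie_skew, hz z h1, neg_zero]
  refine ⟨s, hsc, n, rfl, hn, ?_⟩
  have := dyL_sub k g hx (dyL_of_mem k g S hsc)
  rwa [add_sub_cancel_left] at this

theorem dy_E (S : DySetup k g σ₁ σ₂ c) {x : g} (hx : DyL k g σ₁ σ₂ c x)
    (h : ∀ m, DyL k g σ₁ σ₂ c m → killingForm k g x m = 0) : x = 0 := by
  apply dy_kill_zero k g
  intro y
  have hy : y ∈ ⨆ χ, dyWt k g (fun i : c => (i : g)) χ := by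
    rw [dyWt_top k g (fun i : c => (i : g)) (fun i => S.ss _ i.2) (fun i j => S.cc _ i.2 _ j.2)]; trivial
  have hx0 : x ∈ dyWt k g (fun i : c => (i : g)) 0 := by
    intro i; rw [hx.ac i i.2]; simp
  induction hy using Submodule.iSup_induction' with
  | mem χ y hy =>
    by_cases hχ : χ = 0
    · subst hχ
      have hy0 : ∀ z ∈ c, ⁅z, y⁆ = 0 := fun z hz => by
        have := hy ⟨z, hz⟩
        simpa using this
      have k1 : ∀ y, killingForm k g x (σ₁ y) = - killingForm k g x y := by
        intro y
        rw [← killingForm_of_equiv_apply σ₁, S.i1, hx.a1]; simp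
      have k2 : ∀ y, killingForm k g x (σ₂ y) = - killingForm k g x y := by
        intro y
        rw [← killingForm_of_equiv_apply σ₂, S.i2, hx.a2]; simp
      have hm : DyL k g σ₁ σ₂ c (y - σ₁ y - σ₂ y + σ₁ (σ₂ y)) := by
        refine ⟨?_, ?_, fun z hz => ?_⟩
        · rw [map_add, map_sub, map_sub, S.i1, S.i1]; abel
        · rw [map_add, map_sub, map_sub, S.i2, ← S.i12, ← S.i12, S.i2]; abel
        · rw [lie_add, lie_sub, lie_sub, hy0 z hz, dyC1 k g S hy0 z hz, dyC2 k g S hy0 z hz,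
            dyC1 k g S (dyC2 k g S hy0) z hz]; simp
      have := h _ hm
      simp only [map_add, map_sub, k1, k2] at this
      have h4 : (4 : k) * killingForm k g x y = 0 := by linear_combination this
      simpa using h4
    · exact dyWt_kill k g _ 0 χ x y hx0 hy (by simpa using hχ)
  | zero => simp
  | add _ _ _ _ h h' => rw [map_add, h, h', add_zero]

theorem dy_B (S : DySetup k g σ₁ σ₂ c) {z : g} (hz : z ∈ c)
    (h : ∀ w ∈ c, killingForm k g z w = 0) : z = 0 := by
  apply dy_E k g S (dyL_of_mem k g S hz)
  intro m hm
  obtain ⟨s, hs, n, rfl, hn, hnL⟩ := dy_A k g S hm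
  rw [map_add, h s hs, dy_kill_nilp k g z n (hnL.ac z hz) hn, add_zero]

theorem dy_C (S : DySetup k g σ₁ σ₂ c) {x : g} (hx : DyL k g σ₁ σ₂ c x) : x ∈ c := by
  obtain ⟨s, hs, n, rfl, hn, hnL⟩ := dy_A k g S hx
  have hnc : ∀ n, DyL k g σ₁ σ₂ c n → IsNilpotent (ad k g n) → ∀ z ∈ c, killingForm k g z n = 0 :=
    fun n hnL hn z hz => dy_kill_nilp k g z n (hnL.ac z hz) hn
  suffices n = 0 by rw [this, add_zero]; exact hs
  apply dy_E k g S hnL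
  intro m hm
  obtain ⟨s', hs', n', rfl, hn', hnL'⟩ := dy_A k g S hm
  have hsum := dyL_add k g hnL hnL'
  obtain ⟨s'', hs'', n'', h'', hn'', hnL''⟩ := dy_A k g S hsum
  have h0 : s'' = 0 := by
    apply dy_B k g S hs''
    intro w hw
    have h1 : killingForm k g w (n + n') = killingForm k g w (s'' + n'') := by rw [h'']
    rw [map_add, map_add, hnc n hnL hn w hw, hnc n' hnL' hn' w hw, hnc n'' hnL'' hn'' w hw] at h1
    rw [dy_kill_comm]
    simpa using h1.symm
  rw [h0, zero_add] at h''
  have e1 := dy_kill_nilp k g n n (lie_self n) hn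
  have e2 := dy_kill_nilp k g n' n' (lie_self n') hn'
  have e3 := dy_kill_nilp k g n'' n'' (lie_self n'') hn''
  rw [← h''] at e3
  simp only [map_add, LinearMap.add_apply, e1, e2, dy_kill_comm k g n' n] at e3
  have e4 : killingForm k g n s' = 0 := by rw [dy_kill_comm]; exact hnc n hnL hn s' hs'
  rw [map_add, e4, zero_add]
  have e5 : (2 : k) * killingForm k g n n' = 0 := by linear_combination e3
  simpa using e5

theorem dy_D (S : DySetup k g σ₁ σ₂ c) {y w : g} (y1 : σ₁ y = -y) (y2 : σ₂ y = y)
    (yc : ∀ z ∈ c, ⁅z, y⁆ = 0) (w1 : σ₁ w = w) (w2 : σ₂ w = -w) (wc : ∀ z ∈ c, ⁅z, w⁆ = 0) :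
    ⁅y, w⁆ = 0 := by
  have hL : DyL k g σ₁ σ₂ c ⁅y, w⁆ := by
    refine ⟨?_, ?_, fun z hz => ?_⟩
    · rw [LieEquiv.map_lie, y1, w1, neg_lie]
    · rw [LieEquiv.map_lie, y2, w2, lie_neg]
    · rw [leibniz_lie, yc z hz, wc z hz, zero_lie, lie_zero, add_zero]
  apply dy_B k g S (dy_C k g S hL)
  intro z hz
  rw [dy_kill_inv, ← lie_skew, wc z hz, neg_zero, map_zero]

end CentPart

section KeyPart

variable {σ₁ σ₂ : g ≃ₗ⁅k⁆ g} {c : Submodule k g}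

theorem dy_comm_y (S : DySetup k g σ₁ σ₂ c) {y : g} (y1 : σ₁ y = -y) (y2 : σ₂ y = y)
    (yc : ∀ z ∈ c, ⁅z, y⁆ = 0) (v : g) (v2 : σ₂ v = -v) (vc : ∀ z ∈ c, ⁅z, v⁆ = 0) :
    ⁅y, v⁆ = 0 := by
  have h1 : ⁅y, v + σ₁ v⁆ = 0 := by
    apply dy_D k g S y1 y2 yc
    · rw [map_add, S.i1, add_comm]
    · rw [map_add, ← S.i12, v2, map_neg]; abel
    · intro z hz
      rw [lie_add, vc z hz, dyC1 k g S vc z hz, add_zero]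
  have h2 : ⁅y, v - σ₁ v⁆ = 0 := by
    have hL : DyL k g σ₁ σ₂ c (v - σ₁ v) := by
      refine ⟨?_, ?_, fun z hz => ?_⟩
      · rw [map_sub, S.i1]; abel
      · rw [map_sub, ← S.i12, v2, map_neg]; abel
      · rw [lie_sub, vc z hz, dyC1 k g S vc z hz, sub_zero]
    rw [← lie_skew, yc _ (dy_C k g S hL), neg_zero]
  have h3 : (2 : k) • ⁅y, v⁆ = 0 := by
    rw [lie_add] at h1
    rw [lie_sub] at h2
    rw [two_smul]
    calc ⁅y, v⁆ + ⁅y, v⁆ = (⁅y, v⁆ + ⁅y, σ₁ v⁆) + (⁅y, v⁆ - ⁅y, σ₁ v⁆) := by abel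
      _ = 0 := by rw [h1, h2, add_zero]
  exact (smul_eq_zero.1 h3).resolve_left two_ne_zero

theorem dy_key (S : DySetup k g σ₁ σ₂ c) (φ : g ≃ₗ⁅k⁆ g) (hφ : IsInnerAut k g φ)
    (hconj : ∀ x, σ₂ (φ x) = φ (σ₁ x)) {y : g} (y1 : σ₁ y = -y) (y2 : σ₂ y = y)
    (yc : ∀ z ∈ c, ⁅z, y⁆ = 0) (ys : IsSSElt k g y) : y = 0 := by
  by_contra hy0
  let H : Option c → g := fun o => o.elim y (fun i => (i : g))
  let W : (Option c → k) → Submodule k g := fun χ => dyWt k g H χ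
  let res : (Option c → k) → (c → k) := fun χ i => χ (some i)
  let t : (Option c → k) → (Option c → k) := fun χ o => o.elim (χ none) (fun i => -χ (some i))
  have htop : ⨆ χ, W χ = ⊤ := by
    apply dyWt_top
    · rintro (_ | i)
      · exact ys
      · exact S.ss _ i.2
    · rintro (_ | i) (_ | j)
      · exact lie_self y
      · change ⁅y, (j : g)⁆ = 0
        rw [← lie_skew, yc _ j.2, neg_zero]
      · exact yc _ i.2
      · exact S.cc _ i.2 _ j.2
  have n1 : ∀ χ, ∀ x ∈ W χ, σ₁ x ∈ W (-χ) := by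
    intro χ x hx
    refine dyWt_conj k g H χ (-χ) σ₁ S.i1 (fun _ => -1) ?_ (fun i => by simp) x hx
    rintro (_ | i)
    · change σ₁ y = (-1 : k) • y
      rw [y1]; simp
    · change σ₁ i = (-1 : k) • (i : g)
      rw [S.c1 _ i.2]; simp
  have n2 : ∀ χ, ∀ x ∈ W χ, σ₂ x ∈ W (t χ) := by
    intro χ x hx
    refine dyWt_conj k g H χ (t χ) σ₂ S.i2 (fun o => o.elim 1 (fun _ => -1)) ?_ ?_ x hx
    · rintro (_ | i)
      · change σ₂ y = (1 : k) • y
        rw [y2]; simp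
      · change σ₂ i = (-1 : k) • (i : g)
        rw [S.c2 _ i.2]; simp
    · rintro (_ | i)
      · simp [t]
      · simp [t]
  obtain ⟨P, Padd, P0, Ptri⟩ := dy_order (c → k)
  obtain ⟨P', Padd', P0', Ptri'⟩ := dy_order k
  have hex : ∃ χ, χ none ≠ 0 ∧ ∃ u ∈ W χ, u ≠ 0 := by
    by_contra hcon
    push Not at hcon
    apply hy0
    apply dy_ad_zero k g
    ext x
    have hx : x ∈ ⨆ χ, W χ := by rw [htop]; trivial
    rw [ad_apply, LinearMap.zero_apply]
    induction hx using Submodule.iSup_induction' with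
    | mem χ x hx =>
      have h1 : ⁅y, x⁆ = χ none • x := hx none
      by_cases h0 : χ none = 0
      · rw [h1, h0, zero_smul]
      · rw [hcon χ h0 x hx, lie_zero]
    | zero => simp
    | add _ _ _ _ h h' => rw [lie_add, h, h', add_zero]
  have hex' : ∃ r, P' (r none) ∧ ∃ u ∈ W r, u ≠ 0 := by
    obtain ⟨χ, h0, u, hu, hune⟩ := hex
    rcases Ptri' (χ none) with h | h | h
    · exact absurd h h0
    · exact ⟨χ, h, u, hu, hune⟩
    · refine ⟨-χ, h, σ₁ u, n1 χ u hu, fun h => hune ?_⟩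
      rw [← S.i1 u, h, map_zero]
  obtain ⟨r, hr, u0, hu0, hu0ne⟩ := hex'
  let Idx : (Option c → k) → Prop := fun χ =>
    P (res χ - res r) ∨ (res χ = res r ∧ P' (χ none))
  let U : Submodule k g := ⨆ χ, ⨆ (_ : Idx χ), W χ
  have hUmem : ∀ χ, Idx χ → ∀ x ∈ W χ, x ∈ U := fun χ hχ x hx =>
    Submodule.mem_iSup_of_mem χ (Submodule.mem_iSup_of_mem hχ hx)
  have hUle : ∀ V : Submodule k g, (∀ χ, Idx χ → ∀ x ∈ W χ, x ∈ V) → ∀ x ∈ U, x ∈ V :=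
    fun V hV x hx => by
      have h1 : U ≤ V := iSup₂_le fun χ hχ z hz => hV χ hχ z hz
      exact h1 hx
  have hN1 : ∀ χ, P (res χ) → ∀ x ∈ W χ, ∀ u ∈ U, ⁅x, u⁆ ∈ U := by
    intro χ hχ x hx
    refine hUle (U.comap (ad k g x)) fun χ' hχ' u hu => ?_
    refine hUmem (χ + χ') ?_ _ (dyWt_lie k g H χ χ' x u hx hu)
    left
    have e : res (χ + χ') - res r = res χ + (res χ' - res r) := by
      funext i; simp [res]; ring
    rw [e]
    rcases hχ' with h | ⟨h, -⟩
    · exact Padd _ _ hχ h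
    · rw [h, sub_self, add_zero]; exact hχ
  have hN2 : ∀ b : g, (∀ z ∈ c, ⁅z, b⁆ = 0) → ⁅y, b⁆ = 0 → ∀ u ∈ U, ⁅b, u⁆ ∈ U := by
    intro b hb hyb
    have hb0 : b ∈ W 0 := by
      rintro (_ | i)
      · change ⁅y, b⁆ = (0 : k) • b
        rw [hyb, zero_smul]
      · change ⁅(i : g), b⁆ = (0 : k) • b
        rw [hb _ i.2, zero_smul]
    refine hUle (U.comap (ad k g b)) fun χ' hχ' u hu => ?_
    have := dyWt_lie k g H 0 χ' b u hb0 hu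
    rw [zero_add] at this
    exact hUmem χ' hχ' _ this
  have hdeg : ∀ u ∈ U, killingForm k g u0 (σ₂ u) = 0 := by
    refine hUle (LinearMap.ker ((killingForm k g u0).comp (σ₂.toLinearEquiv : g →ₗ[k] g)))
      fun χ hχ u hu => ?_
    change killingForm k g u0 (σ₂ u) = 0
    refine dyWt_kill k g H r (t χ) u0 (σ₂ u) hu0 (n2 χ u hu) fun h => ?_
    have e1 : res χ = res r := by
      funext i
      have := congrFun h (some i)
      change r (some i) + -χ (some i) = 0 at this
      change χ (some i) = r (some i)
      linear_combination -this
    have e2 : r none + χ none = 0 := congrFun h none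
    rcases hχ with h | ⟨-, h⟩
    · rw [e1, sub_self] at h; exact P0 h
    · apply P0'
      rw [← e2]
      exact Padd' _ _ hr h
  have hdec : ∀ x, ∃ a ∈ {a | σ₂ a = a}, ∃ b, x = a + b ∧ ∀ u ∈ U, ⁅b, u⁆ ∈ U := by
    intro x
    have hx : x ∈ ⨆ χ, W χ := by rw [htop]; trivial
    induction hx using Submodule.iSup_induction' with
    | mem χ x hx =>
      rcases Ptri (res χ) with h | h | h
      · have xc : ∀ z ∈ c, ⁅z, x⁆ = 0 := by
          intro z hz
          have h1 : ⁅z, x⁆ = χ (some ⟨z, hz⟩) • x := hx (some ⟨z, hz⟩)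
          have h2 : χ (some ⟨z, hz⟩) = 0 := congrFun h ⟨z, hz⟩
          rw [h1, h2, zero_smul]
        have vc : ∀ z ∈ c, ⁅z, x - σ₂ x⁆ = 0 := fun z hz => by
          rw [lie_sub, xc z hz, dyC2 k g S xc z hz, sub_zero]
        have v2 : σ₂ (x - σ₂ x) = -(x - σ₂ x) := by rw [map_sub, S.i2]; abel
        refine ⟨(2 : k)⁻¹ • (x + σ₂ x), ?_, (2 : k)⁻¹ • (x - σ₂ x), ?_, ?_⟩
        · change σ₂ _ = _
          rw [map_smul, map_add, S.i2, add_comm]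
        · rw [← smul_add, add_add_sub_cancel, ← two_smul k, smul_smul,
            inv_mul_cancel₀ two_ne_zero, one_smul]
        · apply hN2
          · intro z hz; rw [lie_smul, vc z hz, smul_zero]
          · rw [lie_smul, dy_comm_y k g S y1 y2 yc _ v2 vc, smul_zero]
      · exact ⟨0, map_zero σ₂, x, by simp, hN1 χ h x hx⟩
      · refine ⟨x + σ₂ x, ?_, -σ₂ x, by abel, ?_⟩
        · change σ₂ _ = _
          rw [map_add, S.i2, add_comm]
        · intro u hu
          rw [neg_lie]
          exact U.neg_mem (hN1 (t χ) h _ (n2 χ x hx) u hu)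
    | zero => exact ⟨0, map_zero σ₂, 0, by simp, fun u hu => by simp⟩
    | add x x' _ _ h h' =>
      obtain ⟨a, ha, b, rfl, hb⟩ := h
      obtain ⟨a', ha', b', rfl, hb'⟩ := h'
      refine ⟨a + a', ?_, b + b', by abel, fun u hu => ?_⟩
      · change σ₂ _ = _
        rw [map_add, ha, ha']
      · rw [add_lie]; exact U.add_mem (hb u hu) (hb' u hu)
  obtain ⟨u, huU, hune, hu⟩ := dy_transport k g
    ((killingForm k g).compl₂ (σ₂.toLinearEquiv : g →ₗ[k] g)) {a | σ₂ a = a}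
    (by
      intro a ha x w
      change killingForm k g ⁅a, x⁆ (σ₂ w) + killingForm k g x (σ₂ ⁅a, w⁆) = 0
      have ha' : σ₂ a = a := ha
      rw [LieEquiv.map_lie, ha', ← dy_kill_inv, ← lie_skew a x, map_neg, LinearMap.neg_apply,
        neg_add_cancel])
    U hdec u0 (hUmem r (Or.inr ⟨rfl, hr⟩) u0 hu0) hu0ne hdeg φ.toLinearEquiv hφ
  have hu' : ∀ u' ∈ U, killingForm k g u (σ₁ u') = 0 := by
    intro u' hu'
    have h1 : killingForm k g (φ u) (σ₂ (φ u')) = 0 := hu u' hu'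
    rw [hconj, killingForm_of_equiv_apply] at h1
    exact h1
  apply hune
  apply dy_kill_zero k g
  intro x
  have hx : x ∈ ⨆ χ, W χ := by rw [htop]; trivial
  induction hx using Submodule.iSup_induction' with
  | mem χ x hx =>
    by_cases hχ : Idx (-χ)
    · have := hu' _ (hUmem _ hχ _ (n1 χ x hx))
      rwa [S.i1] at this
    · refine hUle (LinearMap.ker ((killingForm k g).flip x)) (fun χ' hχ' v hv => ?_) u huU
      change killingForm k g v x = 0
      refine dyWt_kill k g H χ' χ v x hv hx fun h => hχ ?_
      rw [← eq_neg_of_add_eq_zero_left h]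
      exact hχ'
  | zero => simp
  | add _ _ _ _ h h' => rw [map_add, h, h', add_zero]

end KeyPart

section FinalPart

theorem dy_q11 (σ₁ σ₂ : g ≃ₗ⁅k⁆ g) (x : g) :
    x ∈ qSpace k g σ₁ σ₂ true true ↔ σ₁ x = -x ∧ σ₂ x = -x := by
  unfold qSpace eigSub
  rw [Submodule.mem_inf, Module.End.mem_eigenspace_iff, Module.End.mem_eigenspace_iff]
  simp

theorem dy_q10 (σ₁ σ₂ : g ≃ₗ⁅k⁆ g) (x : g) :
    x ∈ qSpace k g σ₁ σ₂ true false ↔ σ₁ x = -x ∧ σ₂ x = x := by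
  unfold qSpace eigSub
  rw [Submodule.mem_inf, Module.End.mem_eigenspace_iff, Module.End.mem_eigenspace_iff]
  simp

theorem dy_setup (σ₁ σ₂ : g ≃ₗ⁅k⁆ g) (h1 : IsInvolution k g σ₁) (h2 : IsInvolution k g σ₂)
    (h12 : ∀ x, σ₁ (σ₂ x) = σ₂ (σ₁ x)) (c : Submodule k g)
    (hc : IsCartanSubspace k g (qSpace k g σ₁ σ₂ true true) c) : DySetup k g σ₁ σ₂ c := by
  obtain ⟨hle, hss, hcc, hmax⟩ := hc
  refine ⟨h1, h2, h12, fun x hx => ((dy_q11 k g σ₁ σ₂ x).1 (hle hx)).1,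
    fun x hx => ((dy_q11 k g σ₁ σ₂ x).1 (hle hx)).2, hss, hcc, ?_⟩
  intro s s1 s2 hs hsc
  have hsc' : ∀ z ∈ c, ⁅s, z⁆ = 0 := fun z hz => by rw [← lie_skew, hsc z hz, neg_zero]
  have := hmax (c ⊔ Submodule.span k {s}) (sup_le hle ?_) ?_ ?_ le_sup_left
  · rw [← this]
    exact Submodule.mem_sup_right (Submodule.mem_span_singleton_self s)
  · rw [Submodule.span_singleton_le_iff_mem]
    exact (dy_q11 k g σ₁ σ₂ s).2 ⟨s1, s2⟩
  · intro x hx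
    obtain ⟨a, ha, b, hb, rfl⟩ := Submodule.mem_sup.1 hx
    obtain ⟨t, rfl⟩ := Submodule.mem_span_singleton.1 hb
    exact dy_ss_add k g a (t • s) (hss a ha) (dy_ss_smul k g t s hs)
      (by rw [lie_smul, hsc a ha, smul_zero])
  · intro x hx y hy
    obtain ⟨a, ha, b, hb, rfl⟩ := Submodule.mem_sup.1 hx
    obtain ⟨t, rfl⟩ := Submodule.mem_span_singleton.1 hb
    obtain ⟨a', ha', b', hb', rfl⟩ := Submodule.mem_sup.1 hy
    obtain ⟨t', rfl⟩ := Submodule.mem_span_singleton.1 hb'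
    simp [hsc a ha, hsc' a' ha', hcc a ha a' ha']

theorem dy_half (σ₁ σ₂ : g ≃ₗ⁅k⁆ g) (h1 : IsInvolution k g σ₁) (h2 : IsInvolution k g σ₂)
    (h12 : ∀ x, σ₁ (σ₂ x) = σ₂ (σ₁ x)) (φ : g ≃ₗ⁅k⁆ g) (hφ : IsInnerAut k g φ)
    (hconj : ∀ x, σ₂ (φ x) = φ (σ₁ x)) (c : Submodule k g)
    (hc : IsCartanSubspace k g (qSpace k g σ₁ σ₂ true true) c) :
    IsCartanSubspace k g (qSpace k g σ₁ σ₂ true false ⊔ qSpace k g σ₁ σ₂ true true) c := by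
  have S := dy_setup k g σ₁ σ₂ h1 h2 h12 c hc
  refine ⟨hc.1.trans le_sup_right, hc.2.1, hc.2.2.1, fun c' hle hss hcc hcc' => ?_⟩
  refine le_antisymm (fun x hx => ?_) hcc'
  obtain ⟨a, ha, b, hb, rfl⟩ := Submodule.mem_sup.1 (hle hx)
  obtain ⟨a1, a2⟩ := (dy_q10 k g σ₁ σ₂ a).1 ha
  obtain ⟨b1, b2⟩ := (dy_q11 k g σ₁ σ₂ b).1 hb
  have hz : ∀ z ∈ c, ⁅z, a + b⁆ = 0 := fun z hz => hcc z (hcc' hz) _ hx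
  have hbz : ∀ z ∈ c, ⁅z, b⁆ = 0 := by
    intro z hzc
    have e1 := hz z hzc
    have e2 := dyC2 k g S hz z hzc
    rw [map_add, a2, b2, lie_add, lie_neg] at e2
    rw [lie_add] at e1
    have e3 : (2 : k) • ⁅z, b⁆ = 0 := by
      rw [two_smul]
      calc ⁅z, b⁆ + ⁅z, b⁆ = (⁅z, a⁆ + ⁅z, b⁆) - (⁅z, a⁆ + -⁅z, b⁆) := by abel
        _ = 0 := by rw [e1, e2, sub_zero]
    exact (smul_eq_zero.1 e3).resolve_left two_ne_zero
  have hbc : b ∈ c := dy_C k g S ⟨b1, b2, hbz⟩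
  have hac : a ∈ c' := by
    have := c'.sub_mem hx (hcc' hbc)
    rwa [add_sub_cancel_right] at this
  have ha0 : a = 0 := dy_key k g S φ hφ hconj a1 a2 (fun z hz => hcc z (hcc' hz) a hac) (hss a hac)
  rw [ha0, zero_add]
  exact hbc

theorem dy_q_swap (σ₁ σ₂ : g ≃ₗ⁅k⁆ g) (i j : Bool) :
    qSpace k g σ₁ σ₂ i j = qSpace k g σ₂ σ₁ j i := inf_comm _ _

end FinalPart

/-- If `{σ₁, σ₂}` is a dyad, then any Cartan subspace of `g₁₁` is also
a Cartan subspace of `g₁₀ ⊕ g₁₁` and of `g₀₁ ⊕ g₁₁`. -/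
theorem cartanSubspace_g11_of_dyad (σ₁ σ₂ : g ≃ₗ⁅k⁆ g) (h : IsDyad k g σ₁ σ₂) :
    ∀ c : Submodule k g, IsCartanSubspace k g (qSpace k g σ₁ σ₂ true true) c →
      IsCartanSubspace k g
          (qSpace k g σ₁ σ₂ true false ⊔ qSpace k g σ₁ σ₂ true true) c ∧
        IsCartanSubspace k g
          (qSpace k g σ₁ σ₂ false true ⊔ qSpace k g σ₁ σ₂ true true) c := by
  intro c hc
  obtain ⟨h1, h2, -, h12, φ, hφ, hconj⟩ := h
  have e1 : ∀ x, σ₂ (φ x) = φ (σ₁ x) := fun x => by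
    rw [hconj, LieEquiv.symm_apply_apply]
  have e2 : ∀ x, σ₁ (φ.symm x) = φ.symm (σ₂ x) := fun x => by
    rw [hconj, LieEquiv.symm_apply_apply]
  refine ⟨dy_half k g σ₁ σ₂ h1 h2 h12 φ hφ e1 c hc, ?_⟩
  have hφ' : IsInnerAut k g φ.symm := Subgroup.inv_mem _ hφ
  have := dy_half k g σ₂ σ₁ h2 h1 (fun x => (h12 x).symm) φ.symm hφ' e2 c
    (by rwa [dy_q_swap])
  rwa [dy_q_swap k g σ₁ σ₂ false true, dy_q_swap k g σ₁ σ₂ true true]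
end
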